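/- arXiv:math-ph/0602039 — 4 statements merged into one kernel-verified Lean document; each statement's English description precedes it below -/
import Mathlib

section
/- Let N ≥ 1 and let F be an N×N complex matrix. Then the permanent of F admits the contour-integral representation Per F = (2π)^(−2N) ∫_{[0,2π]^N} ∫_{[0,2π]^N} exp(−i·Σ_{k=1}^N θ_k + i·Σ_{k=1}^N ψ_k) · exp( Σ_{j=1}^N Σ_{k=1}^N e^{−iψ_j} F_{jk} e^{iθ_k} ) dθ_1…dθ_N dψ_1…dψ_N, i.e. the iterated integral over the unit circles parametrized by z_k = e^{iθ_k} and ξ̄_k = e^{−iψ_k} of exp(ξ* F z) against the measure ∏_k dz_k/z_k² · ∏_k dξ̄_k/ξ̄_k² divided by (2π)^{2N} equals Per F. -/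
open MeasureTheory Matrix Finset

/-- The permanent of a square complex matrix. -/
noncomputable def perm {ι : Type*} [Fintype ι] [DecidableEq ι] (M : Matrix ι ι ℂ) : ℂ :=
  ∑ σ : Equiv.Perm ι, ∏ i, M i (σ i)

/-- The cube `[0, 2π]^N` in `Fin N → ℝ`. -/
noncomputable def box (N : ℕ) : Set (Fin N → ℝ) :=
  Set.pi Set.univ fun _ => Set.Icc (0:ℝ) (2 * Real.pi)

theorem volume_restrict_box (N : ℕ) :
    (volume : Measure (Fin N → ℝ)).restrict (box N) =
      Measure.pi fun _ => volume.restrict (Set.Icc (0 : ℝ) (2 * Real.pi)) :=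
  Measure.restrict_pi_pi _ _

theorem integral_box_prod {N : ℕ} (f : Fin N → ℝ → ℂ) :
    ∫ x in box N, ∏ i, f i (x i) = ∏ i, ∫ t in Set.Icc (0 : ℝ) (2 * Real.pi), f i t := by
  rw [volume_restrict_box, integral_fintype_prod_eq_prod]

theorem isCompact_box (N : ℕ) : IsCompact (box N) :=
  isCompact_univ_pi fun _ => isCompact_Icc

/-- The first Taylor coefficient at `0` of `z ↦ exp (a * z)`, as a Cauchy integral. -/
theorem integral_exp_neg_I_mul_exp_mul_exp (a : ℂ) :
    ∫ t in Set.Icc (0 : ℝ) (2 * Real.pi),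
      Complex.exp (-Complex.I * t) * Complex.exp (a * Complex.exp (Complex.I * t)) =
        2 * Real.pi * a := by
  have hderiv : deriv (fun z : ℂ => Complex.exp (a * z)) 0 = a := by
    have h := ((hasDerivAt_id (0 : ℂ)).const_mul a).cexp
    simpa using h.deriv
  have hdiff : DifferentiableOn ℂ (fun z : ℂ => Complex.exp (a * z)) Set.univ := by fun_prop
  have h := Complex.two_pi_I_inv_smul_circleIntegral_sub_sq_inv_smul_of_differentiable
    isOpen_univ (Set.subset_univ (Metric.closedBall (0 : ℂ) 1)) hdiff
    (Metric.mem_ball_self one_pos)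
  rw [hderiv, circleIntegral_def_Icc] at h
  have hcongr : ∀ t : ℝ, deriv (circleMap 0 1) t •
      ((circleMap 0 1 t - 0) ^ 2)⁻¹ • Complex.exp (a * circleMap 0 1 t) =
      Complex.I *
        (Complex.exp (-Complex.I * t) * Complex.exp (a * Complex.exp (Complex.I * t))) := by
    intro t
    have hne := Complex.exp_ne_zero (Complex.I * t)
    simp only [deriv_circleMap, circleMap_zero, Complex.ofReal_one, one_mul, sub_zero, smul_eq_mul,
      mul_comm (t : ℂ) Complex.I, neg_mul, Complex.exp_neg]
    field_simp
  simp only [hcongr] at h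
  rw [integral_const_mul, smul_eq_mul] at h
  have hpi : (Real.pi : ℂ) ≠ 0 := by exact_mod_cast Real.pi_ne_zero
  rw [inv_mul_eq_iff_eq_mul₀ (by simp [hpi])] at h
  refine mul_left_cancel₀ Complex.I_ne_zero (h.trans ?_)
  ring

theorem integral_exp_I_mul :
    ∫ t in Set.Icc (0 : ℝ) (2 * Real.pi), Complex.exp (Complex.I * t) = 0 := by
  rw [integral_Icc_eq_integral_Ioc, ← intervalIntegral.integral_of_le Real.two_pi_pos.le,
    integral_exp_mul_complex Complex.I_ne_zero]
  have : Complex.I * ((2 * Real.pi : ℝ) : ℂ) = 2 * Real.pi * Complex.I := by push_cast; ring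
  rw [this, Complex.exp_two_pi_mul_I]
  simp

theorem integral_box_prod_exp_of_bijective {N : ℕ} {f : Fin N → Fin N}
    (hf : Function.Bijective f) :
    ∫ ψ in box N, ∏ k, (Complex.exp (Complex.I * ψ k) * Complex.exp (-Complex.I * ψ (f k))) =
      (2 * Real.pi) ^ N := by
  have hprod : ∀ ψ : Fin N → ℝ,
      ∏ k, (Complex.exp (Complex.I * ψ k) * Complex.exp (-Complex.I * ψ (f k))) =
        ∏ _k : Fin N, (1 : ℂ) := by
    intro ψ
    rw [prod_mul_distrib, hf.prod_comp fun k => Complex.exp (-Complex.I * ψ k),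
      ← prod_mul_distrib]
    simp [← Complex.exp_add]
  simp only [hprod]
  rw [integral_box_prod fun _ _ => 1]
  simp [Real.pi_pos.le]

theorem integral_box_prod_exp_of_not_surjective {N : ℕ} {f : Fin N → Fin N}
    (hf : ¬ Function.Surjective f) :
    ∫ ψ in box N, ∏ k, (Complex.exp (Complex.I * ψ k) * Complex.exp (-Complex.I * ψ (f k))) =
      0 := by
  obtain ⟨j, hj⟩ : ∃ j, ∀ k, f k ≠ j := by simpa [Function.Surjective] using hf
  have hprod : ∀ ψ : Fin N → ℝ,
      ∏ k, (Complex.exp (Complex.I * ψ k) * Complex.exp (-Complex.I * ψ (f k))) =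
        ∏ k, (Complex.exp (Complex.I * ψ k) *
          ∏ _i with f _i = k, Complex.exp (-Complex.I * ψ k)) := by
    intro ψ
    rw [prod_mul_distrib, prod_mul_distrib,
      prod_fiberwise' univ f fun k => Complex.exp (-Complex.I * ψ k)]
  simp only [hprod]
  rw [integral_box_prod fun k t =>
    Complex.exp (Complex.I * t) * ∏ _i with f _i = k, Complex.exp (-Complex.I * t)]
  refine prod_eq_zero (mem_univ j) ?_
  simp only [hj, filter_false, prod_empty, mul_one, integral_exp_I_mul]

theorem perm_eq_sum_prod_apply {ι : Type*} [Fintype ι] [DecidableEq ι] (M : Matrix ι ι ℂ) :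
    perm M = ∑ σ : Equiv.Perm ι, ∏ k, M (σ k) k := by
  rw [perm, ← Equiv.sum_comp (Equiv.inv (Equiv.Perm ι))]
  refine sum_congr rfl fun σ _ => ?_
  rw [← Equiv.prod_comp σ]
  simp

theorem integral_box_prod_exp_mul_sum {N : ℕ} (F : Matrix (Fin N) (Fin N) ℂ) :
    ∫ ψ in box N, ∏ k, (Complex.exp (Complex.I * ψ k) *
      ∑ j, Complex.exp (-Complex.I * ψ j) * F j k) = (2 * Real.pi) ^ N * perm F := by
  have hexpand : ∀ ψ : Fin N → ℝ,
      ∏ k, (Complex.exp (Complex.I * ψ k) * ∑ j, Complex.exp (-Complex.I * ψ j) * F j k) =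
        ∑ f : Fin N → Fin N, (∏ k, F (f k) k) *
          ∏ k, (Complex.exp (Complex.I * ψ k) * Complex.exp (-Complex.I * ψ (f k))) := by
    intro ψ
    simp only [mul_sum, Fintype.prod_sum]
    refine sum_congr rfl fun f _ => ?_
    rw [← prod_mul_distrib]
    exact prod_congr rfl fun k _ => by ring
  simp only [hexpand]
  rw [integral_finsetSum]
  · simp only [integral_const_mul]
    rw [perm_eq_sum_prod_apply, mul_sum]
    symm
    refine sum_of_injOn (fun σ : Equiv.Perm (Fin N) => (σ : Fin N → Fin N))
      DFunLike.coe_injective.injOn (fun _ _ => by simp) ?_ ?_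
    · intro f _ hf
      rw [integral_box_prod_exp_of_not_surjective, mul_zero]
      intro hsurj
      exact hf ⟨Equiv.ofBijective f (Finite.surjective_iff_bijective.mp hsurj), by simp, rfl⟩
    · intro σ _
      rw [integral_box_prod_exp_of_bijective σ.bijective, mul_comm]
  · intro f _
    exact ContinuousOn.integrableOn_compact (isCompact_box N) (by fun_prop)

/-- The permanent of an `N × N` complex matrix `F` is given by the `2N`-fold contour
integral over unit circles `z_k = e^{iθ_k}`, `ξ̄_k = e^{-iψ_k}` of
`exp(ξ* F z)` against `∏ dz_k/z_k² ∏ dξ̄_k/ξ̄_k² / (2π)^{2N}`. -/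
theorem permanent_contour_integral (N : ℕ) (hN : 1 ≤ N) (F : Matrix (Fin N) (Fin N) ℂ) :
    perm F = ((2 * (Real.pi : ℂ)) ^ (2 * N))⁻¹ *
      ∫ ψ in box N, ∫ θ in box N,
        Complex.exp (-Complex.I * ∑ k, (θ k : ℂ) + Complex.I * ∑ k, (ψ k : ℂ)) *
        Complex.exp (∑ j, ∑ k,
          Complex.exp (-Complex.I * (ψ j : ℂ)) * F j k * Complex.exp (Complex.I * (θ k : ℂ))) := by
  have hinner : ∀ ψ : Fin N → ℝ, (∫ θ in box N,
      Complex.exp (-Complex.I * ∑ k, (θ k : ℂ) + Complex.I * ∑ k, (ψ k : ℂ)) *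
      Complex.exp (∑ j, ∑ k,
        Complex.exp (-Complex.I * (ψ j : ℂ)) * F j k * Complex.exp (Complex.I * (θ k : ℂ)))) =
      (2 * Real.pi) ^ N * ∏ k, (Complex.exp (Complex.I * ψ k) *
        ∑ j, Complex.exp (-Complex.I * ψ j) * F j k) := by
    intro ψ
    have hfactor : ∀ θ : Fin N → ℝ,
        Complex.exp (-Complex.I * ∑ k, (θ k : ℂ) + Complex.I * ∑ k, (ψ k : ℂ)) *
        Complex.exp (∑ j, ∑ k,
          Complex.exp (-Complex.I * (ψ j : ℂ)) * F j k * Complex.exp (Complex.I * (θ k : ℂ))) =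
        (∏ k, Complex.exp (Complex.I * ψ k)) * (∏ k, (Complex.exp (-Complex.I * θ k) *
          Complex.exp ((∑ j, Complex.exp (-Complex.I * ψ j) * F j k) *
            Complex.exp (Complex.I * θ k)))) := by
      intro θ
      rw [sum_comm, prod_mul_distrib]
      simp only [Complex.exp_add, mul_sum, sum_mul, Complex.exp_sum]
      ring
    simp only [hfactor]
    rw [integral_const_mul, integral_box_prod fun k t => Complex.exp (-Complex.I * t) *
      Complex.exp ((∑ j, Complex.exp (-Complex.I * ψ j) * F j k) * Complex.exp (Complex.I * t))]
    simp only [integral_exp_neg_I_mul_exp_mul_exp, prod_mul_distrib, prod_const, card_univ,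
      Fintype.card_fin, mul_pow]
    ring
  simp only [hinner]
  rw [integral_const_mul, integral_box_prod_exp_mul_sum]
  have hpi : (Real.pi : ℂ) ≠ 0 := by exact_mod_cast Real.pi_ne_zero
  field_simp
  ring
end

section
/- Let N ≥ 1, let β ∈ ℂ, let Λ = diag(λ_1,…,λ_N) be a diagonal complex N×N matrix, and let Γ be an N×N complex matrix whose characteristic polynomial is x^{N−1}(x − γ) for some γ ∈ ℂ (i.e. Γ has precisely one nonzero eigenvalue γ and the remaining N−1 eigenvalues equal to zero, counted with multiplicity). Then the Haar-average over the unitary group satisfies ∫_{U(N)} exp( β · Tr(U Λ U* Γ) ) dμ_N(U) = Σ_{n=0}^∞ [ (N−1)! / (N+n−1)! ] · (βγ)^n · h_n(λ_1,…,λ_N), where the series converges absolutely. -/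
open MeasureTheory Matrix Finset Polynomial

instance matMS {m n : Type*} {α : Type*} [MeasurableSpace α] : MeasurableSpace (Matrix m n α) :=
  inferInstanceAs (MeasurableSpace (m → n → α))

open scoped Classical in
/-- The complete homogeneous symmetric polynomial `h_n(x_1, …, x_N)`. -/
noncomputable def hsym (N n : ℕ) (x : Fin N → ℂ) : ℂ :=
  ∑ d ∈ Finset.univ.filter (fun d : Fin n → Fin N => Monotone d), ∏ i, x (d i)

/-- Schur triangularization: every endomorphism of a finite-dimensional complex inner product space
is upper triangular in some orthonormal family of full size. -/
theorem exists_orthonormal_isUpperTriangular (n : ℕ) :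
    ∀ (E : Type) [NormedAddCommGroup E] [InnerProductSpace ℂ E] [FiniteDimensional ℂ E]
      (T : E →ₗ[ℂ] E), Module.finrank ℂ E = n →
      ∃ v : Fin n → E, Orthonormal ℂ v ∧ ∀ i j, j < i → inner ℂ (v i) (T (v j)) = 0 := by
  induction n with
  | zero =>
    intro E _ _ _ T _
    exact ⟨Fin.elim0, ⟨fun i => i.elim0, fun i => i.elim0⟩, fun i => i.elim0⟩
  | succ n ih =>
    intro E _ _ _ T hE
    have : Nontrivial E := Module.nontrivial_of_finrank_pos (R := ℂ) (by omega)
    obtain ⟨μ, hμ⟩ := Module.End.exists_eigenvalue (LinearMap.adjoint T)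
    obtain ⟨w₀, hw₀⟩ := hμ.exists_hasEigenvector
    obtain ⟨w, hw, hw1⟩ : ∃ w : E, LinearMap.adjoint T w = μ • w ∧ ‖w‖ = 1 := by
      refine ⟨((‖w₀‖⁻¹ : ℝ) : ℂ) • w₀, ?_, ?_⟩
      · rw [map_smul, hw₀.apply_eq_smul, smul_comm]
      · have : ‖w₀‖ ≠ 0 := norm_ne_zero_iff.2 hw₀.2
        rw [norm_smul]
        simp [this]
    have hw0 : w ≠ 0 := by
      rintro rfl
      simp at hw1
    have hmem : ∀ x, x ∈ (ℂ ∙ w)ᗮ ↔ inner ℂ w x = 0 := fun x =>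
      Submodule.mem_orthogonal_singleton_iff_inner_right
    have hT : ∀ x ∈ (ℂ ∙ w)ᗮ, T x ∈ (ℂ ∙ w)ᗮ := by
      intro x hx
      rw [hmem] at hx ⊢
      rw [← LinearMap.adjoint_inner_left, hw, inner_smul_left, hx, mul_zero]
    have hfin : Module.finrank ℂ (ℂ ∙ w)ᗮ = n := by
      have h := Submodule.finrank_add_finrank_orthogonal (ℂ ∙ w)
      rw [finrank_span_singleton hw0, hE] at h
      omega
    obtain ⟨v, hv, hvT⟩ := ih _ (T.restrict hT) hfin
    refine ⟨Fin.snoc (fun i => (v i : E)) w, ?_, ?_⟩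
    · rw [orthonormal_iff_ite] at hv ⊢
      intro i j
      have h0 : ∀ i, inner ℂ w (v i : E) = 0 := fun i => (hmem _).1 (v i).2
      induction i using Fin.lastCases with
      | last =>
        induction j using Fin.lastCases with
        | last => simp [hw1]
        | cast j => simp [h0, (Fin.castSucc_lt_last j).ne']
      | cast i =>
        induction j using Fin.lastCases with
        | last =>
          rw [inner_eq_zero_symm.1 (by simpa using h0 i)]
          simp [(Fin.castSucc_lt_last i).ne]
        | cast j => simpa using hv i j
    · intro i j hij
      induction j using Fin.lastCases with
      | last => exact absurd hij (Fin.le_last i).not_gt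
      | cast j =>
        induction i using Fin.lastCases with
        | last => simpa using (hmem _).1 (hT _ (v j).2)
        | cast i => simpa using hvT i j (by simpa using hij)

/-- Schur triangularization of complex square matrices. -/
theorem exists_unitary_conj_isUpperTriangular {N : ℕ} (Γ : Matrix (Fin N) (Fin N) ℂ) :
    ∃ V ∈ Matrix.unitaryGroup (Fin N) ℂ, ∀ i j, j < i → (star V * Γ * V) i j = 0 := by
  obtain ⟨v, hv, hT⟩ := exists_orthonormal_isUpperTriangular N (EuclideanSpace ℂ (Fin N))
    (Matrix.toEuclideanLin Γ) (by simp)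
  rw [orthonormal_iff_ite] at hv
  refine ⟨Matrix.of fun a j => v j a, ?_, ?_⟩
  · rw [Matrix.mem_unitaryGroup_iff']
    ext i j
    rw [Matrix.one_apply, ← hv i j]
    simp [Matrix.mul_apply, Matrix.star_apply, PiLp.inner_apply, mul_comm]
  · intro i j hij
    rw [← hT i j hij, Matrix.mul_assoc]
    simp [Matrix.mul_apply, Matrix.star_apply, PiLp.inner_apply, Matrix.toLpLin_apply,
      Matrix.mulVec, dotProduct, mul_comm]

/-- The homogeneous polynomial function of degree `n` on matrices with coefficient tensor `M`. -/
noncomputable def tensorForm {N n : ℕ} (M : (Fin n → Fin N) → (Fin n → Fin N) → ℂ)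
    (Γ : Matrix (Fin N) (Fin N) ℂ) : ℂ :=
  ∑ i, ∑ j, M i j * ∏ k, Γ (j k) (i k)

theorem trace_mul_pow {N n : ℕ} (A B : Matrix (Fin N) (Fin N) ℂ) :
    (A * B).trace ^ n = tensorForm (fun i j : Fin n → Fin N => ∏ k, A (i k) (j k)) B := by
  simp only [Matrix.trace, Matrix.diag_apply, Matrix.mul_apply, tensorForm,
    Fintype.sum_pow, ← Finset.prod_mul_distrib]
  refine Finset.sum_congr rfl fun i _ => ?_
  exact Fintype.prod_sum (fun k l => A (i k) l * B l (i k))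

theorem tensorForm_smul {N n : ℕ} (M : (Fin n → Fin N) → (Fin n → Fin N) → ℂ) (c : ℂ)
    (Γ : Matrix (Fin N) (Fin N) ℂ) : tensorForm M (c • Γ) = c ^ n * tensorForm M Γ := by
  simp only [tensorForm, Matrix.smul_apply, smul_eq_mul, Finset.prod_mul_distrib, Finset.prod_const,
    Finset.card_univ, Fintype.card_fin, Finset.mul_sum]
  exact Finset.sum_congr rfl fun i _ => Finset.sum_congr rfl fun j _ => by ring

/-- A unitarily invariant form does not see the strictly upper triangular part of a matrix. -/
theorem tensorForm_eq_diagonal {N n : ℕ} (M : (Fin n → Fin N) → (Fin n → Fin N) → ℂ)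
    (hM : ∀ V ∈ Matrix.unitaryGroup (Fin N) ℂ, ∀ Γ,
      tensorForm M (star V * Γ * V) = tensorForm M Γ)
    (T : Matrix (Fin N) (Fin N) ℂ) (hT : ∀ i j, j < i → T i j = 0) :
    tensorForm M T = tensorForm M (Matrix.diagonal fun i => T i i) := by
  let p : ℂ[X] := ∑ i, ∑ j, C (M i j) *
    ∏ k, (C (T (j k) (i k)) * X ^ ((i k : ℕ) - (j k : ℕ)))
  let S : ℂ → Matrix (Fin N) (Fin N) ℂ := fun s => Matrix.of fun a b =>
    T a b * s ^ ((b : ℕ) - (a : ℕ))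
  have hp : ∀ s, p.eval s = tensorForm M (S s) := fun s => by
    simp [p, S, tensorForm, Polynomial.eval_finsetSum, Polynomial.eval_prod]
  have hS0 : S 0 = Matrix.diagonal fun i => T i i := by
    ext a b
    rcases lt_trichotomy a b with h | rfl | h
    · have : (b : ℕ) - (a : ℕ) ≠ 0 := by
        have : (a : ℕ) < b := h
        omega
      simp [S, this, h.ne]
    · simp [S]
    · simp [S, hT a b h, h.ne']
  have hS1 : S 1 = T := by
    ext a b
    simp [S]
  have hcirc : ∀ s ∈ Metric.sphere (0 : ℂ) 1, p.eval s = (C (tensorForm M T)).eval s := by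
    intro s hs
    have hs1 : star s * s = 1 := by
      have : ‖s‖ = 1 := by simpa using hs
      rw [Complex.star_def, Complex.conj_mul', this]
      simp
    have hV : Matrix.diagonal (fun a : Fin N => s ^ (a : ℕ)) ∈ Matrix.unitaryGroup (Fin N) ℂ := by
      rw [Matrix.mem_unitaryGroup_iff', Matrix.star_eq_conjTranspose,
        Matrix.diagonal_conjTranspose, Matrix.diagonal_mul_diagonal, ← Matrix.diagonal_one]
      congr 1
      ext a
      simp only [Pi.star_apply, star_pow, ← mul_pow, hs1, one_pow]
    rw [hp, Polynomial.eval_C, ← hM _ hV T]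
    congr 1
    ext a b
    rw [Matrix.star_eq_conjTranspose, Matrix.diagonal_conjTranspose, Matrix.mul_diagonal,
      Matrix.diagonal_mul]
    rcases lt_or_ge b a with h | h
    · simp [S, hT a b h]
    · have hab : (a : ℕ) ≤ b := h
      obtain ⟨d, hd⟩ := Nat.exists_eq_add_of_le hab
      simp only [S, Matrix.of_apply, Pi.star_apply, star_pow, hd, Nat.add_sub_cancel_left, pow_add]
      have : star s ^ (a : ℕ) * s ^ (a : ℕ) = 1 := by rw [← mul_pow, hs1, one_pow]
      linear_combination (-T a b * s ^ d) * this
  have hinf : (Metric.sphere (0 : ℂ) 1).Infinite := by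
    refine (isPreconnected_sphere (by simp) (0 : ℂ) 1).infinite_of_nontrivial ?_
    exact ⟨1, by simp, -1, by simp, by norm_num⟩
  have hpc : p = C (tensorForm M T) :=
    Polynomial.eq_of_infinite_eval_eq _ _ (hinf.mono hcirc)
  rw [← hS0, ← hp, hpc, Polynomial.eval_C]

/-- A unitarily invariant form takes the value `γ ^ n` times its value at a fixed matrix unit on
every matrix with characteristic polynomial `X ^ (N - 1) * (X - γ)`. -/
theorem tensorForm_of_charpoly {N n : ℕ} (M : (Fin n → Fin N) → (Fin n → Fin N) → ℂ)
    (hM : ∀ V ∈ Matrix.unitaryGroup (Fin N) ℂ, ∀ Γ,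
      tensorForm M (star V * Γ * V) = tensorForm M Γ)
    (Γ : Matrix (Fin N) (Fin N) ℂ) (γ : ℂ) (hΓ : Γ.charpoly = X ^ (N - 1) * (X - C γ))
    (o : Fin N) :
    tensorForm M Γ = γ ^ n * tensorForm M (Matrix.diagonal (Pi.single o 1)) := by
  obtain ⟨V, hV, hT⟩ := exists_unitary_conj_isUpperTriangular Γ
  set T := star V * Γ * V with hTdef
  have hchar : T.charpoly = Γ.charpoly := by
    rw [hTdef, Matrix.charpoly_mul_comm, ← Matrix.mul_assoc, Matrix.mem_unitaryGroup_iff.1 hV,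
      Matrix.one_mul]
  have hroots : Multiset.map (fun i => T i i) univ.val = γ ::ₘ Multiset.replicate (N - 1) 0 := by
    have h1 : T.charpoly = ∏ i, (X - C (T i i)) :=
      Matrix.charpoly_of_isUpperTriangular T fun i j h => hT i j h
    have h2 := congrArg Polynomial.roots (h1.symm.trans (hchar.trans hΓ))
    rw [Polynomial.roots_prod _ _ (Finset.prod_ne_zero_iff.2 fun i _ => X_sub_C_ne_zero _),
      Polynomial.roots_mul (mul_ne_zero (pow_ne_zero _ X_ne_zero) (X_sub_C_ne_zero _))] at h2
    simp only [roots_X_sub_C, Multiset.bind_singleton, roots_pow, roots_X,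
      Multiset.nsmul_singleton] at h2
    rw [h2, add_comm, Multiset.singleton_add]
  obtain ⟨l, -, hl⟩ := Multiset.mem_map.1 (hroots ▸ Multiset.mem_cons_self γ _ :
    γ ∈ Multiset.map (fun i => T i i) univ.val)
  have hrest : ∀ i, i ≠ l → T i i = 0 := by
    intro i hi
    have h3 : univ.val = l ::ₘ (univ.erase l).val := by
      rw [Finset.erase_val, Multiset.cons_erase (Finset.mem_univ l)]
    rw [h3, Multiset.map_cons, hl, Multiset.cons_inj_right] at hroots
    refine Multiset.eq_of_mem_replicate (n := N - 1) (hroots ▸ ?_)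
    exact Multiset.mem_map_of_mem (fun i => T i i) (Finset.mem_erase.2 ⟨hi, Finset.mem_univ i⟩)
  have hdiag : (Matrix.diagonal fun i => T i i) =
      γ • Matrix.diagonal (Pi.single l (1 : ℂ)) := by
    rw [← Matrix.diagonal_smul]
    congr 1
    ext i
    by_cases h : i = l
    · subst h
      simp [hl]
    · simp [h, hrest i h]
  rw [← hM V hV Γ, ← hTdef, tensorForm_eq_diagonal M hM T hT, hdiag, tensorForm_smul]
  congr 1
  have hsymm : star ((Equiv.swap o l).permMatrix ℂ) = (Equiv.swap o l).permMatrix ℂ := by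
    rw [Matrix.star_eq_conjTranspose, Matrix.conjTranspose_permMatrix, Equiv.swap_inv]
  have hP : (Equiv.swap o l).permMatrix ℂ ∈ Matrix.unitaryGroup (Fin N) ℂ := by
    rw [Matrix.mem_unitaryGroup_iff', hsymm, ← Matrix.permMatrix_mul, Equiv.swap_mul_self,
      Matrix.permMatrix_one]
  rw [← hM _ hP, hsymm]
  congr 1
  rw [PEquiv.toMatrix_toPEquiv_mul, PEquiv.mul_toMatrix_toPEquiv, Matrix.submatrix_submatrix,
    Equiv.symm_swap, Function.comp_id, Function.id_comp,
    Matrix.submatrix_diagonal _ _ (Equiv.swap o l).injective]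
  congr 1
  ext a
  simp [Pi.single_apply, Equiv.swap_apply_eq_iff]

/-- The trace of the `n`-th tensor power of `A * B` composed with a permutation of the factors is
unchanged when `A` and `B` are swapped. -/
theorem sum_prod_perm_mul_comm {N n : ℕ} (A B : Matrix (Fin N) (Fin N) ℂ)
    (σ : Equiv.Perm (Fin n)) :
    ∑ i : Fin n → Fin N, ∏ k, (A * B) (i k) (i (σ k)) =
      ∑ i : Fin n → Fin N, ∏ k, (B * A) (i k) (i (σ k)) := by
  simp only [Matrix.mul_apply, Fintype.prod_sum, Finset.prod_mul_distrib]
  rw [Finset.sum_comm]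
  have hcomp : Function.Bijective fun l : Fin n → Fin N => l ∘ σ :=
    (Equiv.arrowCongr σ.symm (Equiv.refl (Fin N))).bijective
  rw [← hcomp.sum_comp]
  refine Finset.sum_congr rfl fun l _ => Finset.sum_congr rfl fun i _ => ?_
  rw [mul_comm]
  congr 1
  exact Equiv.prod_comp σ fun k => B (l k) (i k)

theorem sum_prod_perm_conj {N n : ℕ} (D U : Matrix (Fin N) (Fin N) ℂ)
    (hU : U ∈ Matrix.unitaryGroup (Fin N) ℂ) (σ : Equiv.Perm (Fin n)) :
    ∑ i : Fin n → Fin N, ∏ k, (U * D * star U) (i k) (i (σ k)) =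
      ∑ i : Fin n → Fin N, ∏ k, D (i k) (i (σ k)) := by
  rw [sum_prod_perm_mul_comm, ← Matrix.mul_assoc, Matrix.mem_unitaryGroup_iff'.1 hU,
    Matrix.one_mul]

theorem prod_diagonal_perm {N n : ℕ} (lam : Fin N → ℂ) (i : Fin n → Fin N)
    (σ : Equiv.Perm (Fin n)) :
    ∏ k, Matrix.diagonal lam (i k) (i (σ k)) = if i ∘ σ = i then ∏ k, lam (i k) else 0 := by
  split_ifs with h
  · refine Finset.prod_congr rfl fun k _ => ?_
    rw [show i (σ k) = i k from congrFun h k, Matrix.diagonal_apply_eq]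
  · obtain ⟨k, hk⟩ := Function.ne_iff.1 h
    exact Finset.prod_eq_zero (Finset.mem_univ k) (Matrix.diagonal_apply_ne' _ hk)

/-- As many permutations stabilize a tuple as sort it. -/
theorem sum_stabilizer_eq_sum_monotone {N n : ℕ} (i : Fin n → Fin N) (c : ℂ) :
    open scoped Classical in
    (∑ σ : Equiv.Perm (Fin n), if i ∘ σ = i then c else 0) =
      ∑ σ : Equiv.Perm (Fin n), if Monotone (i ∘ σ) then c else 0 := by
  classical
  rw [← Equiv.sum_comp (Equiv.mulRight (Tuple.sort i))
    (fun σ : Equiv.Perm (Fin n) => if Monotone (i ∘ σ) then c else 0)]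
  refine Finset.sum_congr rfl fun σ _ => ?_
  congr 1
  rw [← Tuple.comp_sort_eq_comp_iff_monotone, Equiv.coe_mulRight, Equiv.Perm.coe_mul,
    ← Function.comp_assoc, (Tuple.sort i).surjective.injective_comp_right.eq_iff]

theorem sum_prod_diagonal_eq_hsym (N n : ℕ) (lam : Fin N → ℂ) :
    ∑ σ : Equiv.Perm (Fin n), ∑ i : Fin n → Fin N,
      ∏ k, Matrix.diagonal lam (i k) (i (σ k)) = (n.factorial : ℂ) * hsym N n lam := by
  classical
  simp only [prod_diagonal_perm]
  rw [Finset.sum_comm]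
  have h1 : ∀ i : Fin n → Fin N,
      (∑ σ : Equiv.Perm (Fin n), if i ∘ σ = i then ∏ k, lam (i k) else 0) =
      ∑ σ : Equiv.Perm (Fin n), if Monotone (i ∘ σ) then ∏ k, lam ((i ∘ σ) k) else 0 := by
    intro i
    have h := sum_stabilizer_eq_sum_monotone i (∏ k, lam (i k))
    have h2 : ∀ σ : Equiv.Perm (Fin n), ∏ k, lam ((i ∘ σ) k) = ∏ k, lam (i k) := fun σ =>
      Equiv.prod_comp σ fun k => lam (i k)
    simp only [h2]
    convert h
  simp only [h1]
  rw [Finset.sum_comm]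
  have h3 : ∀ σ : Equiv.Perm (Fin n),
      (∑ i : Fin n → Fin N, if Monotone (i ∘ σ) then ∏ k, lam ((i ∘ σ) k) else 0) =
      hsym N n lam := by
    intro σ
    have hcomp : Function.Bijective fun l : Fin n → Fin N => l ∘ σ :=
      (Equiv.arrowCongr σ.symm (Equiv.refl (Fin N))).bijective
    rw [hcomp.sum_comp (fun d : Fin n → Fin N => if Monotone d then ∏ k, lam (d k) else 0), hsym,
      Finset.sum_filter]
  simp only [h3, Finset.sum_const, Finset.card_univ, Fintype.card_perm, Fintype.card_fin,
    nsmul_eq_mul]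

/-- Monotone tuples are counted by multisets. -/
theorem card_monotone_fin (N n : ℕ) :
    open scoped Classical in
    (Finset.univ.filter (fun d : Fin n → Fin N => Monotone d)).card = (N + n - 1).choose n := by
  classical
  have h := Sym.card_sym_eq_choose (α := Fin N) n
  rw [Fintype.card_fin] at h
  rw [← h, ← Finset.card_univ]
  refine Finset.card_bij (fun d _ => ⟨Multiset.ofList (List.ofFn d), by simp⟩)
    (fun _ _ => Finset.mem_univ _) ?_ ?_
  · intro d hd e he hde
    simp only [Finset.mem_filter, Finset.mem_univ, true_and] at hd he
    have hp : (List.ofFn d).Perm (List.ofFn e) := Quotient.exact (congrArg Subtype.val hde)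
    exact List.ofFn_injective (hp.eq_of_pairwise' hd.sortedLE_ofFn.pairwise
      he.sortedLE_ofFn.pairwise)
  · rintro ⟨s, hs⟩ -
    induction s using Quotient.inductionOn with
    | h l =>
      have hl : l.length = n := by simpa using hs
      subst hl
      refine ⟨l.get ∘ Tuple.sort l.get, ?_, ?_⟩
      · simpa using Tuple.monotone_sort l.get
      · refine Subtype.ext (Quotient.sound (s := List.isSetoid _) ?_)
        have h := Equiv.Perm.ofFn_comp_perm (Tuple.sort l.get) l.get
        rwa [List.ofFn_get] at h

theorem hsym_one (N n : ℕ) : hsym N n (fun _ => 1) = ((N + n - 1).choose n : ℂ) := by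
  rw [hsym, ← card_monotone_fin]
  simp

/-- Tuples with fibres of the same size differ by a permutation. -/
theorem exists_perm_comp_eq {N n : ℕ} (i j : Fin n → Fin N)
    (h : ∀ a, Fintype.card {k // i k = a} = Fintype.card {k // j k = a}) :
    ∃ σ : Equiv.Perm (Fin n), i ∘ σ = j := by
  let e := fun a => (Fintype.equivOfCardEq (h a)).symm
  refine ⟨(Equiv.sigmaFiberEquiv j).symm.trans
    ((Equiv.sigmaCongrRight e).trans (Equiv.sigmaFiberEquiv i)), ?_⟩
  ext k
  exact congrArg Fin.val (e (j k) ⟨k, rfl⟩).2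

/-- The number of permutations taking `i` to `j` depends only on the sizes of the fibres. -/
theorem card_perm_comp_eq {N n : ℕ} (i j : Fin n → Fin N) :
    (∑ σ : Equiv.Perm (Fin n), if i ∘ σ = j then (1 : ℂ) else 0) =
      if (∀ a, Fintype.card {k // i k = a} = Fintype.card {k // j k = a}) then
        ∏ a, ((Fintype.card {k // i k = a}).factorial : ℂ) else 0 := by
  split_ifs with h
  · obtain ⟨τ, rfl⟩ := exists_perm_comp_eq i j h
    rw [← Equiv.sum_comp (Equiv.mulRight τ)]
    have := DomMulAct.stabilizer_card i
    simp only [Equiv.coe_mulRight, Equiv.Perm.coe_mul, ← Function.comp_assoc,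
      τ.surjective.injective_comp_right.eq_iff]
    rw [Finset.sum_boole, ← Fintype.card_subtype, this, Nat.cast_prod]
  · refine Finset.sum_eq_zero fun σ _ => if_neg ?_
    rintro rfl
    refine h fun a => (Fintype.card_congr (σ.subtypeEquiv fun k => Iff.rfl)).symm

/-- If a form restricted to rank-one matrices is a multiple of the `n`-th power of the trace, then
so is its contraction with the symmetrizer. -/
theorem sum_perm_eq_of_vecMulVec {N n : ℕ} (M : (Fin n → Fin N) → (Fin n → Fin N) → ℂ) (c : ℂ)
    (h : ∀ x y : Fin N → ℂ, tensorForm M (Matrix.vecMulVec x y) = c * (x ⬝ᵥ y) ^ n) :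
    ∑ σ : Equiv.Perm (Fin n), ∑ i : Fin n → Fin N, M i (i ∘ σ) =
      c * (n.factorial * (N + n - 1).choose n) := by
  let L : MvPolynomial (Fin N ⊕ Fin N) ℂ →ₗ[ℂ] ℂ :=
    (MvPolynomial.basisMonomials (Fin N ⊕ Fin N) ℂ).constr ℂ fun m =>
      if (∀ a, m (Sum.inl a) = m (Sum.inr a)) then ∏ a, ((m (Sum.inl a)).factorial : ℂ) else 0
  have hL : ∀ i j : Fin n → Fin N,
      L (∏ k, (MvPolynomial.X (Sum.inr (j k)) * MvPolynomial.X (Sum.inl (i k)))) =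
        ∑ σ : Equiv.Perm (Fin n), if i ∘ σ = j then (1 : ℂ) else 0 := by
    intro i j
    have hmon : ∏ k, (MvPolynomial.X (Sum.inr (j k)) * MvPolynomial.X (Sum.inl (i k))) =
        MvPolynomial.monomial (R := ℂ) (∑ k, (Finsupp.single (Sum.inr (j k) : Fin N ⊕ Fin N) 1 +
          Finsupp.single (Sum.inl (i k)) 1)) 1 := by
      rw [MvPolynomial.monomial_sum_one]
      exact Finset.prod_congr rfl fun k _ => by
        rw [MvPolynomial.X, MvPolynomial.X, MvPolynomial.monomial_mul, one_mul]
    have hb := (MvPolynomial.basisMonomials (Fin N ⊕ Fin N) ℂ).constr_basis ℂ (fun m =>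
      if (∀ a, m (Sum.inl a) = m (Sum.inr a)) then ∏ a, ((m (Sum.inl a)).factorial : ℂ) else 0)
    simp only [MvPolynomial.coe_basisMonomials] at hb
    rw [card_perm_comp_eq, hmon, hb]
    simp only [Finsupp.finsetSum_apply, Finsupp.add_apply, Finsupp.single_apply, reduceCtorEq,
      Sum.inl.injEq, Sum.inr.injEq, if_false, zero_add, add_zero, Finset.sum_boole,
      Fintype.card_subtype, Nat.cast_id]
  let P : ((Fin n → Fin N) → (Fin n → Fin N) → ℂ) → MvPolynomial (Fin N ⊕ Fin N) ℂ := fun M =>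
    ∑ i, ∑ j, M i j • ∏ k, (MvPolynomial.X (Sum.inr (j k)) * MvPolynomial.X (Sum.inl (i k)))
  have hLP : ∀ M, L (P M) = ∑ σ : Equiv.Perm (Fin n), ∑ i : Fin n → Fin N, M i (i ∘ σ) := by
    intro M
    simp only [P, map_sum, map_smul, hL, smul_eq_mul, Finset.mul_sum]
    conv_rhs => rw [Finset.sum_comm]
    refine Finset.sum_congr rfl fun i _ => ?_
    rw [Finset.sum_comm]
    simp
  have heval : ∀ M v, MvPolynomial.eval v (P M) =
      tensorForm M (Matrix.vecMulVec (v ∘ Sum.inr) (v ∘ Sum.inl)) := by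
    intro M v
    simp [P, tensorForm, Matrix.vecMulVec_apply, MvPolynomial.smul_eval]
  let δ : (Fin n → Fin N) → (Fin n → Fin N) → ℂ := fun i j =>
    ∏ k, (1 : Matrix (Fin N) (Fin N) ℂ) (i k) (j k)
  have hP : P M = c • P δ := by
    refine MvPolynomial.funext fun v => ?_
    rw [MvPolynomial.smul_eval, heval, heval, h, ← trace_mul_pow, Matrix.one_mul,
      Matrix.trace_vecMulVec]
  rw [← hLP, hP, map_smul, hLP, ← hsym_one, ← sum_prod_diagonal_eq_hsym]
  simp only [smul_eq_mul, δ, ← Matrix.diagonal_one]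
  rfl

theorem measurable_unitary_entry {N : ℕ} (i j : Fin N) :
    Measurable fun U : Matrix.unitaryGroup (Fin N) ℂ => (U : Matrix (Fin N) (Fin N) ℂ) i j :=
  (measurable_pi_apply j).comp ((measurable_pi_apply i).comp measurable_subtype_coe)

theorem measurable_unitary_conj_entry {N : ℕ} (D : Matrix (Fin N) (Fin N) ℂ) (i j : Fin N) :
    Measurable fun U : Matrix.unitaryGroup (Fin N) ℂ =>
      ((U : Matrix (Fin N) (Fin N) ℂ) * D * star (U : Matrix (Fin N) (Fin N) ℂ)) i j := by
  simp only [Matrix.mul_apply, Matrix.star_apply]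
  refine Finset.measurable_sum _ fun k _ => Measurable.mul
    (Finset.measurable_sum _ fun l _ => (measurable_unitary_entry _ _).mul_const _)
    (Complex.continuous_conj.measurable.comp (measurable_unitary_entry _ _))

theorem norm_unitary_conj_entry_le {N : ℕ} (D : Matrix (Fin N) (Fin N) ℂ) (i j : Fin N)
    (U : Matrix.unitaryGroup (Fin N) ℂ) :
    ‖((U : Matrix (Fin N) (Fin N) ℂ) * D * star (U : Matrix (Fin N) (Fin N) ℂ)) i j‖ ≤
      ∑ k, ∑ l, ‖D l k‖ := by
  simp only [Matrix.mul_apply, Matrix.star_apply]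
  refine (norm_sum_le _ _).trans (Finset.sum_le_sum fun k _ => ?_)
  rw [norm_mul, norm_star]
  refine (mul_le_of_le_one_right (norm_nonneg _) (entry_norm_bound_of_unitary U.2 _ _)).trans ?_
  refine (norm_sum_le _ _).trans (Finset.sum_le_sum fun l _ => ?_)
  rw [norm_mul]
  exact mul_le_of_le_one_left (norm_nonneg _) (entry_norm_bound_of_unitary U.2 _ _)

theorem integrable_prod_unitary_conj {N n : ℕ} (D : Matrix (Fin N) (Fin N) ℂ)
    (μH : Measure (Matrix.unitaryGroup (Fin N) ℂ)) [IsProbabilityMeasure μH]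
    (i j : Fin n → Fin N) :
    Integrable (fun U : Matrix.unitaryGroup (Fin N) ℂ => ∏ k,
      ((U : Matrix (Fin N) (Fin N) ℂ) * D * star (U : Matrix (Fin N) (Fin N) ℂ)) (i k) (j k))
      μH := by
  refine Integrable.of_bound (C := ∏ _k : Fin n, ∑ k, ∑ l, ‖D l k‖)
    (Finset.measurable_prod _ fun k _ => measurable_unitary_conj_entry D _ _).aestronglyMeasurable
    (Filter.Eventually.of_forall fun U => ?_)
  rw [norm_prod]
  exact Finset.prod_le_prod (fun _ _ => norm_nonneg _) fun k _ => norm_unitary_conj_entry_le D _ _ U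

/-- The tensor of moments of the entries of `U * D * star U`. -/
noncomputable def unitaryMoment {N n : ℕ} (D : Matrix (Fin N) (Fin N) ℂ)
    (μH : Measure (Matrix.unitaryGroup (Fin N) ℂ)) (i j : Fin n → Fin N) : ℂ :=
  ∫ U : Matrix.unitaryGroup (Fin N) ℂ, ∏ k,
    ((U : Matrix (Fin N) (Fin N) ℂ) * D * star (U : Matrix (Fin N) (Fin N) ℂ)) (i k) (j k) ∂μH

theorem integral_trace_pow {N n : ℕ} (D Γ : Matrix (Fin N) (Fin N) ℂ)
    (μH : Measure (Matrix.unitaryGroup (Fin N) ℂ)) [IsProbabilityMeasure μH] :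
    ∫ U : Matrix.unitaryGroup (Fin N) ℂ, Matrix.trace ((U : Matrix (Fin N) (Fin N) ℂ) * D *
      star (U : Matrix (Fin N) (Fin N) ℂ) * Γ) ^ n ∂μH =
      tensorForm (unitaryMoment (n := n) D μH) Γ := by
  simp only [trace_mul_pow, tensorForm, unitaryMoment]
  rw [integral_finsetSum _ fun i _ => integrable_finsetSum _ fun j _ =>
    (integrable_prod_unitary_conj D μH i j).mul_const _]
  refine Finset.sum_congr rfl fun i _ => ?_
  rw [integral_finsetSum _ fun j _ => (integrable_prod_unitary_conj D μH i j).mul_const _]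
  exact Finset.sum_congr rfl fun j _ => integral_mul_const _ _

theorem measurable_trace_unitary_conj {N : ℕ} (D Γ : Matrix (Fin N) (Fin N) ℂ) :
    Measurable fun U : Matrix.unitaryGroup (Fin N) ℂ => Matrix.trace
      ((U : Matrix (Fin N) (Fin N) ℂ) * D * star (U : Matrix (Fin N) (Fin N) ℂ) * Γ) := by
  simp only [Matrix.trace, Matrix.diag_apply, Matrix.mul_apply (N := Γ)]
  exact Finset.measurable_sum _ fun i _ => Finset.measurable_sum _ fun j _ =>
    (measurable_unitary_conj_entry D _ _).mul_const _

theorem norm_trace_unitary_conj_le {N : ℕ} (D Γ : Matrix (Fin N) (Fin N) ℂ)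
    (U : Matrix.unitaryGroup (Fin N) ℂ) :
    ‖Matrix.trace ((U : Matrix (Fin N) (Fin N) ℂ) * D *
      star (U : Matrix (Fin N) (Fin N) ℂ) * Γ)‖ ≤
      ∑ i, ∑ j, (∑ k, ∑ l, ‖D l k‖) * ‖Γ j i‖ := by
  simp only [Matrix.trace, Matrix.diag_apply, Matrix.mul_apply (N := Γ)]
  refine (norm_sum_le _ _).trans (Finset.sum_le_sum fun i _ => ?_)
  refine (norm_sum_le _ _).trans (Finset.sum_le_sum fun j _ => ?_)
  rw [norm_mul]
  exact mul_le_mul_of_nonneg_right (norm_unitary_conj_entry_le D _ _ U) (norm_nonneg _)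

theorem measurable_unitary_mul_left {N : ℕ} (V : Matrix.unitaryGroup (Fin N) ℂ) :
    Measurable fun U : Matrix.unitaryGroup (Fin N) ℂ => V * U := by
  refine Measurable.subtype_mk (measurable_pi_iff.2 fun i => measurable_pi_iff.2 fun j => ?_)
  simp only [Matrix.mul_apply]
  exact Finset.measurable_sum _ fun k _ => (measurable_unitary_entry _ _).const_mul _

theorem tensorForm_unitaryMoment_conj {N n : ℕ} (D Γ : Matrix (Fin N) (Fin N) ℂ)
    (μH : Measure (Matrix.unitaryGroup (Fin N) ℂ)) [IsProbabilityMeasure μH]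
    (hinv : ∀ V : Matrix.unitaryGroup (Fin N) ℂ, μH.map (fun U => V * U) = μH)
    (V : Matrix (Fin N) (Fin N) ℂ) (hV : V ∈ Matrix.unitaryGroup (Fin N) ℂ) :
    tensorForm (unitaryMoment (n := n) D μH) (star V * Γ * V) =
      tensorForm (unitaryMoment (n := n) D μH) Γ := by
  rw [← integral_trace_pow, ← integral_trace_pow]
  conv_rhs => rw [← hinv ⟨V, hV⟩]
  rw [integral_map (measurable_unitary_mul_left _).aemeasurable
    ((measurable_trace_unitary_conj D Γ).pow_const n).aestronglyMeasurable]
  refine integral_congr_ae (Filter.Eventually.of_forall fun U => ?_)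
  simp only [Submonoid.coe_mul, star_mul]
  congr 1
  rw [← Matrix.mul_assoc, Matrix.trace_mul_comm]
  simp only [Matrix.mul_assoc]

/-- Moments of the trace of `U * diagonal lam * star U * Γ` for a matrix `Γ` with at most one
nonzero eigenvalue. -/
theorem integral_trace_pow_eq_hsym {N n : ℕ} (hN : 1 ≤ N) (γ : ℂ) (lam : Fin N → ℂ)
    (Γ : Matrix (Fin N) (Fin N) ℂ) (hΓ : Γ.charpoly = X ^ (N - 1) * (X - C γ))
    (μH : Measure (Matrix.unitaryGroup (Fin N) ℂ)) [IsProbabilityMeasure μH]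
    (hinv : ∀ V : Matrix.unitaryGroup (Fin N) ℂ, μH.map (fun U => V * U) = μH) :
    ∫ U : Matrix.unitaryGroup (Fin N) ℂ, Matrix.trace ((U : Matrix (Fin N) (Fin N) ℂ) *
      Matrix.diagonal lam * star (U : Matrix (Fin N) (Fin N) ℂ) * Γ) ^ n ∂μH =
      (n.factorial * (N - 1).factorial / (N + n - 1).factorial) * γ ^ n * hsym N n lam := by
  let o : Fin N := ⟨0, hN⟩
  have key : ∀ (Γ : Matrix (Fin N) (Fin N) ℂ) (γ : ℂ), Γ.charpoly = X ^ (N - 1) * (X - C γ) →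
      tensorForm (unitaryMoment (n := n) (Matrix.diagonal lam) μH) Γ = γ ^ n *
      tensorForm (unitaryMoment (n := n) (Matrix.diagonal lam) μH)
        (Matrix.diagonal (Pi.single o 1)) := fun Γ γ hΓ =>
    tensorForm_of_charpoly _ (fun V hV Γ => tensorForm_unitaryMoment_conj _ Γ μH hinv V hV) Γ γ hΓ o
  set c := tensorForm (unitaryMoment (n := n) (Matrix.diagonal lam) μH)
    (Matrix.diagonal (Pi.single o 1))
  have hc := sum_perm_eq_of_vecMulVec (unitaryMoment (n := n) (Matrix.diagonal lam) μH) c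
    fun x y => by
      rw [key (Matrix.vecMulVec x y) (x ⬝ᵥ y), mul_comm]
      rw [Matrix.charpoly_vecMulVec, Fintype.card_fin, mul_sub, ← pow_succ, Nat.sub_add_cancel hN,
        mul_comm (X ^ (N - 1)) (C _), Polynomial.smul_eq_C_mul]
  have hsum : ∑ σ : Equiv.Perm (Fin n), ∑ i : Fin n → Fin N,
      unitaryMoment (Matrix.diagonal lam) μH i (i ∘ σ) = n.factorial * hsym N n lam := by
    rw [← sum_prod_diagonal_eq_hsym]
    refine Finset.sum_congr rfl fun σ _ => ?_
    simp only [unitaryMoment]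
    rw [← integral_finsetSum _ fun i _ => integrable_prod_unitary_conj _ μH i (i ∘ σ)]
    simp only [Function.comp_apply, sum_prod_perm_conj _ _ (Subtype.prop _)]
    simp
  rw [hsum] at hc
  have hn : (n.factorial : ℂ) ≠ 0 := Nat.cast_ne_zero.2 n.factorial_ne_zero
  have hfact : ((N + n - 1).choose n : ℂ) * n.factorial * (N - 1).factorial =
      (N + n - 1).factorial := by
    have h := Nat.choose_mul_factorial_mul_factorial (show n ≤ N + n - 1 by omega)
    rw [show N + n - 1 - n = N - 1 by omega] at h
    exact_mod_cast h
  have hne : ((N + n - 1).factorial : ℂ) ≠ 0 := Nat.cast_ne_zero.2 (Nat.factorial_ne_zero _)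
  have hh : hsym N n lam = c * (N + n - 1).choose n := by
    refine mul_left_cancel₀ hn ?_
    rw [hc]
    ring
  rw [integral_trace_pow, key Γ γ hΓ, hh, div_mul_eq_mul_div, div_mul_eq_mul_div, eq_div_iff hne,
    ← hfact]
  ring

/-- Rank-one Harish-Chandra–Itzykson–Zuber formula: if `Γ` has precisely one nonzero
eigenvalue `γ` (its characteristic polynomial being `x^{N-1}(x-γ)`), and `μH` is the Haar
probability measure on `U(N)` (the left-invariant probability measure), then
`∫_{U(N)} exp(β Tr(U Λ U* Γ)) dμ_N(U) = Σ_{n≥0} (N-1)!/(N+n-1)! (βγ)^n h_n(λ)`,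
the series converging absolutely. -/
theorem hciz_rank_one (N : ℕ) (hN : 1 ≤ N) (β γ : ℂ) (lam : Fin N → ℂ)
    (Γ : Matrix (Fin N) (Fin N) ℂ)
    (hΓ : Γ.charpoly = X ^ (N - 1) * (X - C γ))
    (μH : Measure (Matrix.unitaryGroup (Fin N) ℂ)) [IsProbabilityMeasure μH]
    (hinv : ∀ V : Matrix.unitaryGroup (Fin N) ℂ, μH.map (fun U => V * U) = μH) :
    Summable (fun n : ℕ =>
      ‖(((N - 1).factorial : ℂ) / ((N + n - 1).factorial : ℂ)) * (β * γ) ^ n * hsym N n lam‖)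
    ∧ (∫ U : Matrix.unitaryGroup (Fin N) ℂ,
        Complex.exp (β * Matrix.trace ((U : Matrix (Fin N) (Fin N) ℂ) * Matrix.diagonal lam *
          star (U : Matrix (Fin N) (Fin N) ℂ) * Γ)) ∂μH)
      = ∑' n : ℕ,
          (((N - 1).factorial : ℂ) / ((N + n - 1).factorial : ℂ)) * (β * γ) ^ n * hsym N n lam := by
  let t : Matrix.unitaryGroup (Fin N) ℂ → ℂ := fun U =>
    β * Matrix.trace ((U : Matrix (Fin N) (Fin N) ℂ) * Matrix.diagonal lam *
      star (U : Matrix (Fin N) (Fin N) ℂ) * Γ)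
  obtain ⟨B, hB⟩ : ∃ B : ℝ, ∀ U, ‖t U‖ ≤ B := ⟨_, fun U => by
    rw [norm_mul]
    exact mul_le_mul_of_nonneg_left (norm_trace_unitary_conj_le _ Γ U) (norm_nonneg β)⟩
  have htm : Measurable t := (measurable_trace_unitary_conj _ Γ).const_mul β
  have hbound : ∀ n U, ‖t U ^ n / (n.factorial : ℂ)‖ ≤ B ^ n / n.factorial := fun n U => by
    rw [norm_div, norm_pow, Complex.norm_natCast]
    exact div_le_div_of_nonneg_right (pow_le_pow_left₀ (norm_nonneg _) (hB U) n)
      (Nat.cast_nonneg _)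
  have hint : ∀ n : ℕ, Integrable (fun U => t U ^ n / (n.factorial : ℂ)) μH := fun n =>
    Integrable.of_bound ((htm.pow_const n).div_const _).aestronglyMeasurable _
      (Filter.Eventually.of_forall (hbound n))
  have hterm : ∀ n : ℕ, ∫ U, t U ^ n / (n.factorial : ℂ) ∂μH =
      (((N - 1).factorial : ℂ) / ((N + n - 1).factorial : ℂ)) * (β * γ) ^ n * hsym N n lam := by
    intro n
    have hn : (n.factorial : ℂ) ≠ 0 := Nat.cast_ne_zero.2 n.factorial_ne_zero
    simp only [t, mul_pow]
    rw [integral_div, integral_const_mul, integral_trace_pow_eq_hsym hN γ lam Γ hΓ μH hinv]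
    field_simp
  have hsumB : Summable fun n : ℕ => B ^ n / (n.factorial : ℝ) := Real.summable_pow_div_factorial B
  have hsum : Summable fun n : ℕ => ∫ U, ‖t U ^ n / (n.factorial : ℂ)‖ ∂μH := by
    refine hsumB.of_nonneg_of_le (fun n => integral_nonneg fun U => norm_nonneg _) fun n => ?_
    refine (integral_mono (hint n).norm (integrable_const _) (hbound n)).trans_eq ?_
    simp
  refine ⟨hsum.of_nonneg_of_le (fun n => norm_nonneg _) fun n => ?_, ?_⟩
  · rw [← hterm]
    exact norm_integral_le_integral_norm _
  · rw [← tsum_congr hterm, integral_tsum_of_summable_integral_norm hint hsum]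
    refine integral_congr_ae (Filter.Eventually.of_forall fun U => ?_)
    change Complex.exp (t U) = _
    rw [Complex.exp_eq_exp_ℂ, NormedSpace.exp_eq_tsum_div]
end

section
/- Let N ≥ 1 and let γ_GUE be the GUE probability measure on N×N complex Hermitian matrices. Then for every μ ∈ ℂ, ∫ Per(μ·1_N − H) dγ_GUE(H) = i^N · ∫ det(−iμ·1_N − H) dγ_GUE(H); that is, the GUE-expected permanental polynomial p(μ) = Per(μ·1_N − H) equals i^N times the GUE-expected characteristic polynomial d(z) = det(z·1_N − H) evaluated at z = −iμ. -/
open MeasureTheory Matrix Finset Polynomial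

/-- The Hermitian matrix built from the coordinates: diagonal entries `x.1 i`, and for
`i < j` the entry `H_ij = (Re H_ij) + i (Im H_ij)` given by the pair `x.2 ⟨(i,j), _⟩`. -/
noncomputable def hermOf (m : ℕ)
    (x : (Fin m → ℝ) × ({p : Fin m × Fin m // p.1 < p.2} → ℝ × ℝ)) :
    Matrix (Fin m) (Fin m) ℂ := fun i j =>
  if h : i < j then ((x.2 ⟨(i, j), h⟩).1 : ℂ) + ((x.2 ⟨(i, j), h⟩).2 : ℂ) * Complex.I
  else if h' : j < i then ((x.2 ⟨(j, i), h'⟩).1 : ℂ) - ((x.2 ⟨(j, i), h'⟩).2 : ℂ) * Complex.I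
  else ((x.1 i : ℝ) : ℂ)

/-- The Gaussian probability measure on `m × m` complex Hermitian matrices with density
`2^{-m/2} (N/π)^{m²/2} exp(-(N/2) Tr H²)` with respect to Lebesgue measure in the
coordinates `(H_ii)_i, (Re H_ij, Im H_ij)_{i<j}`.  For `m = N` this is the GUE measure. -/
noncomputable def gaussHerm (N m : ℕ) : Measure (Matrix (Fin m) (Fin m) ℂ) :=
  Measure.map (hermOf m) (volume.withDensity fun x =>
    ENNReal.ofReal ((2 : ℝ) ^ (-(m : ℝ) / 2) * ((N : ℝ) / Real.pi) ^ ((m : ℝ) ^ 2 / 2) *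
      Real.exp (-(N : ℝ) / 2 * (Matrix.trace (hermOf m x ^ 2)).re)))

/-- Coordinates on the space of `m × m` Hermitian matrices. -/
abbrev HermCoord (m : ℕ) := (Fin m → ℝ) × ({p : Fin m × Fin m // p.1 < p.2} → ℝ × ℝ)

lemma hermOf_swap {m : ℕ} (x : HermCoord m) (i j : Fin m) :
    hermOf m x j i = (starRingEnd ℂ) (hermOf m x i j) := by
  rcases lt_trichotomy i j with h | rfl | h
  · simp [hermOf, h, h.not_gt, sub_eq_add_neg]
  · simp [hermOf]
  · simp [hermOf, h, h.not_gt]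

lemma trace_hermOf_sq {m : ℕ} (x : HermCoord m) :
    (Matrix.trace (hermOf m x ^ 2)).re = ∑ i, ∑ j, Complex.normSq (hermOf m x i j) := by
  simp only [Matrix.trace, Matrix.diag_apply, pow_two, Matrix.mul_apply, Complex.re_sum]
  refine sum_congr rfl fun i _ => sum_congr rfl fun j _ => ?_
  rw [hermOf_swap x i j, Complex.mul_conj, Complex.ofReal_re]

lemma measurable_hermOf_apply {m : ℕ} (i j : Fin m) :
    Measurable fun x : HermCoord m => hermOf m x i j := by
  unfold hermOf
  split_ifs <;> fun_prop

lemma measurable_hermOf (m : ℕ) : Measurable (hermOf m) :=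
  measurable_pi_iff.2 fun i => measurable_pi_iff.2 fun j => measurable_hermOf_apply i j

lemma measurable_matrix_apply {m : ℕ} (i j : Fin m) :
    Measurable fun H : Matrix (Fin m) (Fin m) ℂ => H i j :=
  (measurable_pi_apply j).comp (measurable_pi_apply (X := fun _ => Fin m → ℂ) i)

/-- The density of `gaussHerm N m` in coordinates. -/
noncomputable def gaussDensity (N m : ℕ) (x : HermCoord m) : ℝ :=
  (2 : ℝ) ^ (-(m : ℝ) / 2) * ((N : ℝ) / Real.pi) ^ ((m : ℝ) ^ 2 / 2) *
      Real.exp (-(N : ℝ) / 2 * (Matrix.trace (hermOf m x ^ 2)).re)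

lemma gaussHerm_eq (N m : ℕ) : gaussHerm N m =
    Measure.map (hermOf m) (volume.withDensity fun x => ENNReal.ofReal (gaussDensity N m x)) :=
  rfl

lemma gaussDensity_nonneg (N m : ℕ) (x : HermCoord m) : 0 ≤ gaussDensity N m x := by
  unfold gaussDensity; positivity

lemma measurable_gaussDensity (N m : ℕ) : Measurable (gaussDensity N m) := by
  unfold gaussDensity
  simp only [trace_hermOf_sq]
  have h : Measurable fun x : HermCoord m => ∑ i, ∑ j, Complex.normSq (hermOf m x i j) :=
    Finset.measurable_sum _ fun i _ => Finset.measurable_sum _ fun j _ =>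
      Complex.continuous_normSq.measurable.comp (measurable_hermOf_apply i j)
  fun_prop

/-- Multiplying the Hermitian coordinates by signs. -/
def flipCoord {m : ℕ} (ε : Fin m → Fin m → ℝ) (x : HermCoord m) : HermCoord m :=
  (fun a => ε a a * x.1 a, fun p => ε p.1.1 p.1.2 • x.2 p)

lemma hermOf_flipCoord {m : ℕ} {ε : Fin m → Fin m → ℝ} (hε : ∀ a b, ε a b = ε b a)
    (x : HermCoord m) (a b : Fin m) :
    hermOf m (flipCoord ε x) a b = ε a b * hermOf m x a b := by
  rcases lt_trichotomy a b with h | rfl | h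
  · simp [hermOf, flipCoord, h]; ring
  · simp [hermOf, flipCoord]
  · simp [hermOf, flipCoord, h, h.not_gt, hε b a]; ring

lemma gaussDensity_flipCoord {N m : ℕ} {ε : Fin m → Fin m → ℝ} (hε : ∀ a b, ε a b = ε b a)
    (hε' : ∀ a b, ε a b = 1 ∨ ε a b = -1) (x : HermCoord m) :
    gaussDensity N m (flipCoord ε x) = gaussDensity N m x := by
  have h (a b) : Complex.normSq (ε a b : ℂ) = 1 := by rcases hε' a b with h | h <;> simp [h]
  simp only [gaussDensity, trace_hermOf_sq, hermOf_flipCoord hε, map_mul, h, one_mul]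

lemma measurePreserving_flipCoord {m : ℕ} {ε : Fin m → Fin m → ℝ}
    (hε : ∀ a b, ε a b = 1 ∨ ε a b = -1) :
    MeasurePreserving (flipCoord ε) (volume : Measure (HermCoord m)) volume := by
  have hneg : MeasurePreserving (fun y : ℝ => -y) volume volume :=
    Measure.measurePreserving_neg volume
  refine MeasurePreserving.prod
    (volume_preserving_pi (f := fun a (y : ℝ) => ε a a * y) fun a => ?_)
    (volume_preserving_pi (f := fun (p : {p : Fin m × Fin m // p.1 < p.2}) (y : ℝ × ℝ) =>
      ε p.1.1 p.1.2 • y) fun p => ?_)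
  · rcases hε a a with h | h
    · simpa [h] using! MeasurePreserving.id volume
    · simpa [h] using hneg
  · rcases hε p.1.1 p.1.2 with h | h
    · simpa [h] using! MeasurePreserving.id volume
    · simpa [h] using! hneg.prod hneg

/-- The Gaussian Hermitian measure is invariant under symmetric sign changes of the entries. -/
lemma measurePreserving_sign_gaussHerm {N m : ℕ} {ε : Fin m → Fin m → ℝ}
    (hε : ∀ a b, ε a b = ε b a) (hε' : ∀ a b, ε a b = 1 ∨ ε a b = -1) :
    MeasurePreserving (fun H : Matrix (Fin m) (Fin m) ℂ => Matrix.of fun a b => ε a b * H a b)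
      (gaussHerm N m) (gaussHerm N m) := by
  have hflip := measurePreserving_flipCoord hε'
  have hmeas : Measurable
      (fun H : Matrix (Fin m) (Fin m) ℂ => Matrix.of fun a b => (ε a b : ℂ) * H a b) :=
    measurable_pi_iff.2 fun i => measurable_pi_iff.2 fun j =>
      (measurable_matrix_apply i j).const_mul _
  refine ⟨hmeas, ?_⟩
  rw [gaussHerm_eq, Measure.map_map hmeas (measurable_hermOf m)]
  have hcomp : (fun H : Matrix (Fin m) (Fin m) ℂ => Matrix.of fun a b => (ε a b : ℂ) * H a b) ∘
      hermOf m = hermOf m ∘ flipCoord ε := by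
    ext x a b
    simp [hermOf_flipCoord hε]
  rw [hcomp, ← Measure.map_map (measurable_hermOf m) hflip.measurable]
  congr 1
  ext s hs
  rw [Measure.map_apply hflip.measurable hs, withDensity_apply _ (hflip.measurable hs),
    withDensity_apply _ hs, ← hflip.setLIntegral_comp_preimage hs
      (measurable_gaussDensity N m).ennreal_ofReal]
  simp only [gaussDensity_flipCoord hε hε']

lemma integral_gaussHerm_sign {N m : ℕ} {ε : Fin m → Fin m → ℝ}
    (hε : ∀ a b, ε a b = ε b a) (hε' : ∀ a b, ε a b = 1 ∨ ε a b = -1)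
    {F : Matrix (Fin m) (Fin m) ℂ → ℂ} (hF : Measurable F) :
    ∫ H, F (Matrix.of fun a b => ε a b * H a b) ∂gaussHerm N m = ∫ H, F H ∂gaussHerm N m := by
  have h := measurePreserving_sign_gaussHerm (N := N) hε hε'
  conv_rhs => rw [← h.map_eq]
  rw [integral_map h.measurable.aemeasurable hF.aestronglyMeasurable]

lemma integrable_exp_neg_trace {m : ℕ} {c : ℝ} (hc : 0 < c) :
    Integrable fun x : HermCoord m =>
      Real.exp (-c * (Matrix.trace (hermOf m x ^ 2)).re) := by
  have h1 : Integrable fun y : ℝ => Real.exp (-(c / 2) * y ^ 2) :=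
    integrable_exp_neg_mul_sq (half_pos hc)
  have h2 : Integrable fun y : ℝ × ℝ =>
      Real.exp (-(c / 2) * y.1 ^ 2) * Real.exp (-(c / 2) * y.2 ^ 2) := h1.mul_prod h1
  have h3 : Integrable fun x : HermCoord m => (∏ i, Real.exp (-(c / 2) * x.1 i ^ 2)) *
      ∏ p, (Real.exp (-(c / 2) * (x.2 p).1 ^ 2) * Real.exp (-(c / 2) * (x.2 p).2 ^ 2)) :=
    Integrable.mul_prod (Integrable.fintype_prod (f := fun _ (y : ℝ) => _) fun _ => h1)
      (Integrable.fintype_prod (f := fun _ (y : ℝ × ℝ) => _) fun _ => h2)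
  refine h3.mono' ?_ (Filter.Eventually.of_forall fun x => ?_)
  · simp only [trace_hermOf_sq]
    have h : Measurable fun x : HermCoord m => ∑ i, ∑ j, Complex.normSq (hermOf m x i j) :=
      Finset.measurable_sum _ fun i _ => Finset.measurable_sum _ fun j _ =>
        Complex.continuous_normSq.measurable.comp (measurable_hermOf_apply i j)
    exact (by fun_prop : Measurable _).aestronglyMeasurable
  · simp only [← Real.exp_add, ← Real.exp_sum]
    rw [Real.norm_of_nonneg (Real.exp_nonneg _), Real.exp_le_exp, trace_hermOf_sq]
    have hd : ∑ i, x.1 i ^ 2 ≤ ∑ i, ∑ j, Complex.normSq (hermOf m x i j) := by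
      refine sum_le_sum fun i _ => ?_
      have := single_le_sum (f := fun j => Complex.normSq (hermOf m x i j))
        (fun j _ => Complex.normSq_nonneg _) (mem_univ i)
      simpa [hermOf, Complex.normSq_ofReal, pow_two] using this
    have ho : ∑ p, ((x.2 p).1 ^ 2 + (x.2 p).2 ^ 2) ≤
        ∑ i, ∑ j, Complex.normSq (hermOf m x i j) := by
      rw [← Finset.sum_product', Finset.univ_product_univ]
      calc ∑ p, ((x.2 p).1 ^ 2 + (x.2 p).2 ^ 2)
          = ∑ p : {p : Fin m × Fin m // p.1 < p.2},
              Complex.normSq (hermOf m x p.1.1 p.1.2) := by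
            refine sum_congr rfl fun p _ => ?_
            simp [hermOf, p.2, Complex.normSq_add_mul_I]
        _ = ∑ p : Fin m × Fin m with p.1 < p.2, Complex.normSq (hermOf m x p.1 p.2) :=
            (Finset.sum_subtype _ (by simp)
              fun p : Fin m × Fin m => Complex.normSq (hermOf m x p.1 p.2)).symm
        _ ≤ _ := sum_le_sum_of_subset_of_nonneg (filter_subset _ _)
            fun _ _ _ => Complex.normSq_nonneg _
    simp only [← mul_add, ← Finset.mul_sum]
    nlinarith

lemma norm_hermOf_le {m : ℕ} (x : HermCoord m) (i j : Fin m) :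
    ‖hermOf m x i j‖ ≤ 1 + (Matrix.trace (hermOf m x ^ 2)).re := by
  rw [trace_hermOf_sq]
  have h1 := single_le_sum (f := fun j => Complex.normSq (hermOf m x i j))
    (fun j _ => Complex.normSq_nonneg _) (mem_univ j)
  have h2 := single_le_sum (f := fun i => ∑ j, Complex.normSq (hermOf m x i j))
    (fun i _ => sum_nonneg fun j _ => Complex.normSq_nonneg _) (mem_univ i)
  have h3 := Complex.normSq_eq_norm_sq (hermOf m x i j)
  replace h2 := h1.trans h2
  rw [h3] at h2
  nlinarith [sq_nonneg (‖hermOf m x i j‖ - 1)]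

/-- A partial product of entries of a shifted matrix along a map of the indices. -/
noncomputable def entryProd {m : ℕ} (c : Fin m → ℂ) (f : Fin m → Fin m) (S : Finset (Fin m))
    (H : Matrix (Fin m) (Fin m) ℂ) : ℂ :=
  ∏ i ∈ S, (c i - H i (f i))

lemma measurable_entryProd {m : ℕ} (c : Fin m → ℂ) (f : Fin m → Fin m) (S : Finset (Fin m)) :
    Measurable (entryProd c f S) :=
  Finset.measurable_fun_prod _ fun i _ => (measurable_matrix_apply i (f i)).const_sub _

lemma integrable_entryProd {N m : ℕ} (hN : 1 ≤ N) (c : Fin m → ℂ) (f : Fin m → Fin m)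
    (S : Finset (Fin m)) : Integrable (entryProd c f S) (gaussHerm N m) := by
  have hF := measurable_entryProd c f S
  have hN' : (0 : ℝ) < N := by exact_mod_cast hN
  rw [gaussHerm_eq, integrable_map_measure hF.aestronglyMeasurable
    (measurable_hermOf m).aemeasurable,
    integrable_withDensity_iff_integrable_smul' (measurable_gaussDensity N m).ennreal_ofReal
      (Filter.Eventually.of_forall fun x => ENNReal.ofReal_lt_top)]
  simp only [ENNReal.toReal_ofReal (gaussDensity_nonneg N m _)]
  set K : ℝ := 1 + ∑ i, ‖c i‖
  set δ : ℝ := N / 4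
  have hδ : 0 < δ := by positivity
  set k := #S
  set A : ℝ := (2 : ℝ) ^ (-(m : ℝ) / 2) * ((N : ℝ) / Real.pi) ^ ((m : ℝ) ^ 2 / 2) with hA
  have hA0 : 0 ≤ A := by positivity
  refine ((integrable_exp_neg_trace (m := m) hδ).const_mul
    (A * (k.factorial / δ ^ k * Real.exp (δ * K)))).mono' ?_
    (Filter.Eventually.of_forall fun x => ?_)
  · exact ((measurable_gaussDensity N m).smul
      (hF.comp (measurable_hermOf m))).aestronglyMeasurable
  · set T := (Matrix.trace (hermOf m x ^ 2)).re with hT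
    have hT0 : 0 ≤ T := by
      rw [hT, trace_hermOf_sq]
      exact sum_nonneg fun i _ => sum_nonneg fun j _ => Complex.normSq_nonneg _
    have hK0 : 0 ≤ K + T := by positivity
    have hprod : ‖entryProd c f S (hermOf m x)‖ ≤ (K + T) ^ k := by
      rw [entryProd, norm_prod]
      refine (prod_le_prod (fun i _ => norm_nonneg _) fun i _ => ?_).trans_eq (prod_const (K + T))
      have h1 := norm_sub_le (c i) (hermOf m x i (f i))
      have h2 := norm_hermOf_le x i (f i)
      have h3 := single_le_sum (f := fun i => ‖c i‖) (fun i _ => norm_nonneg _) (mem_univ i)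
      simp only [K]
      linarith
    have hpow : (K + T) ^ k ≤ k.factorial / δ ^ k * Real.exp (δ * (K + T)) := by
      have := Real.pow_div_factorial_le_exp (δ * (K + T)) (by positivity) k
      rw [div_le_iff₀ (by positivity), mul_pow] at this
      rw [div_mul_eq_mul_div, le_div_iff₀ (by positivity)]
      linarith
    rw [norm_smul, Real.norm_of_nonneg (gaussDensity_nonneg N m x), gaussDensity, ← hA, ← hT]
    calc A * Real.exp (-(N : ℝ) / 2 * T) * ‖(entryProd c f S ∘ hermOf m) x‖
        ≤ A * Real.exp (-(N : ℝ) / 2 * T) *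
            (k.factorial / δ ^ k * Real.exp (δ * (K + T))) := by
          gcongr
          exact hprod.trans hpow
      _ = A * (k.factorial / δ ^ k) *
            (Real.exp (-(N : ℝ) / 2 * T) * Real.exp (δ * (K + T))) := by ring
      _ = A * (k.factorial / δ ^ k) * (Real.exp (δ * K) * Real.exp (-δ * T)) := by
          rw [← Real.exp_add, ← Real.exp_add]
          congr 2
          ring
      _ = _ := by ring

/-- The sign pattern changing exactly the entries at `(i, j)` and `(j, i)`. -/
def pairSign {m : ℕ} (i j a b : Fin m) : ℝ :=
  if (a = i ∧ b = j) ∨ (a = j ∧ b = i) then -1 else 1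

lemma pairSign_comm {m : ℕ} (i j a b : Fin m) : pairSign i j a b = pairSign i j b a := by
  unfold pairSign
  congr 1
  grind

lemma pairSign_eq_or {m : ℕ} (i j a b : Fin m) :
    pairSign i j a b = 1 ∨ pairSign i j a b = -1 := by
  unfold pairSign; split_ifs <;> simp

lemma entryProd_pairSign_of_forall {m : ℕ} {c : Fin m → ℂ} {f : Fin m → Fin m}
    {S : Finset (Fin m)} {i j : Fin m}
    (h : ∀ a ∈ S, ¬((a = i ∧ f a = j) ∨ (a = j ∧ f a = i))) (H : Matrix (Fin m) (Fin m) ℂ) :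
    entryProd c f S (Matrix.of fun a b => (pairSign i j a b : ℂ) * H a b) =
      entryProd c f S H := by
  refine prod_congr rfl fun a ha => ?_
  simp [pairSign, h a ha]

/-- An off-diagonal entry whose transpose does not occur in the product kills the expectation. -/
lemma integral_entryProd_eq_zero {N m : ℕ} {c : Fin m → ℂ} {f : Fin m → Fin m} {i : Fin m}
    (hc : c i = 0) (hi : f (f i) ≠ i) :
    ∫ H, entryProd c f univ H ∂gaussHerm N m = 0 := by
  have h := integral_gaussHerm_sign (N := N) (pairSign_comm i (f i)) (pairSign_eq_or i (f i))
    (measurable_entryProd c f univ)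
  have hflip (H : Matrix (Fin m) (Fin m) ℂ) :
      entryProd c f univ (Matrix.of fun a b => (pairSign i (f i) a b : ℂ) * H a b) =
        -entryProd c f univ H := by
    rw [← insert_erase (mem_univ i), entryProd, entryProd, prod_insert (by simp),
      prod_insert (by simp), ← entryProd, ← entryProd, entryProd_pairSign_of_forall]
    · simp [pairSign, hc]
    · intro a ha
      have := ne_of_mem_erase ha
      grind
  simp only [hflip, integral_neg] at h
  linear_combination -h / 2

/-- In expectation, diagonal factors may be replaced by the shift. -/
lemma integral_entryProd_fixed {N m : ℕ} (hN : 1 ≤ N) {c : Fin m → ℂ} {f : Fin m → Fin m}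
    {S R : Finset (Fin m)} (hS : ∀ i ∈ S, f i = i) (hSR : Disjoint S R) :
    ∫ H, entryProd c f (S ∪ R) H ∂gaussHerm N m =
      (∏ i ∈ S, c i) * ∫ H, entryProd c f R H ∂gaussHerm N m := by
  induction S using Finset.induction_on with
  | empty => simp
  | insert i S hi ih =>
    rw [disjoint_insert_left] at hSR
    have hiU : i ∉ S ∪ R := by simp [hi, hSR.1]
    have hfi : f i = i := hS i (mem_insert_self i S)
    rw [prod_insert hi, mul_assoc, ← ih (fun a ha => hS a (mem_insert_of_mem ha)) hSR.2,
      insert_union]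
    have h := integral_gaussHerm_sign (N := N) (pairSign_comm i i) (pairSign_eq_or i i)
      (measurable_entryProd c f (insert i (S ∪ R)))
    have hflip (H : Matrix (Fin m) (Fin m) ℂ) :
        entryProd c f (insert i (S ∪ R))
            (Matrix.of fun a b => (pairSign i i a b : ℂ) * H a b) =
          2 * c i * entryProd c f (S ∪ R) H - entryProd c f (insert i (S ∪ R)) H := by
      rw [entryProd, entryProd, entryProd, prod_insert hiU, prod_insert hiU, ← entryProd,
        ← entryProd, entryProd_pairSign_of_forall]
      · simp [pairSign, hfi]; ring
      · intro a ha
        have : a ≠ i := fun h => hiU (h ▸ ha)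
        simp [this]
    simp only [hflip] at h
    rw [integral_sub ((integrable_entryProd hN c f _).const_mul _) (integrable_entryProd hN c f _),
      integral_const_mul] at h
    linear_combination -h / 2

/-- The diagonal shift seen along a permutation. -/
def shift {m : ℕ} (z : ℂ) (σ : Equiv.Perm (Fin m)) (i : Fin m) : ℂ := if σ i = i then z else 0

lemma entryProd_shift {m : ℕ} (z : ℂ) (σ : Equiv.Perm (Fin m)) (H : Matrix (Fin m) (Fin m) ℂ) :
    entryProd (shift z σ) σ univ H =
      ∏ i, (z • (1 : Matrix (Fin m) (Fin m) ℂ) - H) i (σ i) := by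
  refine prod_congr rfl fun i _ => ?_
  simp [shift, Matrix.one_apply, eq_comm]

lemma integral_entryProd_shift {N m : ℕ} (hN : 1 ≤ N) (z : ℂ) (σ : Equiv.Perm (Fin m)) :
    ∫ H, entryProd (shift z σ) σ univ H ∂gaussHerm N m =
      z ^ (m - #σ.support) * ∫ H, entryProd 0 σ σ.support H ∂gaussHerm N m := by
  have h := integral_entryProd_fixed hN (c := shift z σ) (f := σ) (S := σ.supportᶜ)
    (R := σ.support) (by simp) disjoint_compl_left
  rw [union_comm, union_compl] at h
  rw [h]
  congr 1
  · rw [prod_congr rfl (g := fun _ => z) (fun i hi => by simp_all [shift]), prod_const, card_compl,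
      Fintype.card_fin]
  · refine integral_congr_ae (Filter.Eventually.of_forall fun H => prod_congr rfl fun i hi => ?_)
    simp_all [shift]

lemma I_pow_mul_sign_mul {m : ℕ} {σ : Equiv.Perm (Fin m)} (hσ : σ ^ 2 = 1) (μ : ℂ) :
    Complex.I ^ m * ((Equiv.Perm.sign σ : ℤ) * (-Complex.I * μ) ^ (m - #σ.support)) =
      μ ^ (m - #σ.support) := by
  obtain ⟨k, hk⟩ := Equiv.Perm.two_dvd_card_support hσ
  have hle : #σ.support ≤ m := by simpa using card_le_univ σ.support
  have hsign : Equiv.Perm.sign σ = (-1) ^ k := by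
    rw [Equiv.Perm.sign_of_pow_two_eq_one hσ, Equiv.Perm.card_fixedPoints,
      Equiv.Perm.sum_cycleType, hk, Fintype.card_fin]
    congr 1
    omega
  obtain ⟨d, hd⟩ := Nat.exists_eq_add_of_le hle
  rw [hsign, show m - #σ.support = d by omega, show m = 2 * k + d by omega, pow_add, pow_mul, Complex.I_sq, mul_pow]
  push_cast
  have h1 : ((-1 : ℂ) ^ k) * (-1) ^ k = 1 := by rw [← mul_pow]; simp
  have h2 : Complex.I ^ d * (-Complex.I) ^ d = 1 := by rw [← mul_pow]; simp
  linear_combination μ ^ d * (Complex.I ^ d * (-Complex.I) ^ d) * h1 + μ ^ d * h2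

lemma integral_entryProd_shift_rotate {N m : ℕ} (hN : 1 ≤ N) (μ : ℂ) (σ : Equiv.Perm (Fin m)) :
    ∫ H, entryProd (shift μ σ) σ univ H ∂gaussHerm N m = Complex.I ^ m *
      ((Equiv.Perm.sign σ : ℤ) *
        ∫ H, entryProd (shift (-Complex.I * μ) σ) σ univ H ∂gaussHerm N m) := by
  by_cases hσ : σ ^ 2 = 1
  · rw [integral_entryProd_shift hN, integral_entryProd_shift hN]
    linear_combination -(∫ H, entryProd 0 σ σ.support H ∂gaussHerm N m) *
      I_pow_mul_sign_mul hσ μ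
  · obtain ⟨i, hi⟩ : ∃ i, σ (σ i) ≠ i := by
      by_contra! h
      exact hσ (Equiv.ext fun i => by simpa [pow_two] using h i)
    have hfix : σ i ≠ i := fun h => hi (by rw [h, h])
    rw [integral_entryProd_eq_zero (i := i) (by simp [shift, hfix]) hi,
      integral_entryProd_eq_zero (i := i) (by simp [shift, hfix]) hi]
    simp

/-- The GUE-expected permanental polynomial equals `i^N` times the GUE-expected
characteristic polynomial at `-iμ`:
`⟨Per(μ·1 - H)⟩_GUE = i^N ⟨det(-iμ·1 - H)⟩_GUE`. -/
theorem gue_expected_permanental_polynomial (N : ℕ) (hN : 1 ≤ N) (μ : ℂ) :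
    (∫ H, perm (μ • (1 : Matrix (Fin N) (Fin N) ℂ) - H) ∂(gaussHerm N N))
      = Complex.I ^ N *
        ∫ H, Matrix.det ((-Complex.I * μ) • (1 : Matrix (Fin N) (Fin N) ℂ) - H)
          ∂(gaussHerm N N) := by
  have hperm (H : Matrix (Fin N) (Fin N) ℂ) : perm (μ • (1 : Matrix (Fin N) (Fin N) ℂ) - H) =
      ∑ σ : Equiv.Perm (Fin N), entryProd (shift μ σ) σ univ H := by
    simp only [entryProd_shift, perm]
  have hdet (H : Matrix (Fin N) (Fin N) ℂ) :
      Matrix.det ((-Complex.I * μ) • (1 : Matrix (Fin N) (Fin N) ℂ) - H) =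
        ∑ σ : Equiv.Perm (Fin N), ((Equiv.Perm.sign σ : ℤ) : ℂ) *
          entryProd (shift (-Complex.I * μ) σ) σ univ H := by
    rw [← Matrix.det_transpose, Matrix.det_apply']
    simp only [entryProd_shift, Matrix.transpose_apply]
  simp only [hperm, hdet]
  rw [integral_finsetSum _ fun σ _ => integrable_entryProd hN _ _ _,
    integral_finsetSum _ fun σ _ => (integrable_entryProd hN _ _ _).const_mul _, mul_sum]
  refine sum_congr rfl fun σ _ => ?_
  rw [integral_const_mul, integral_entryProd_shift_rotate hN]
end

section
/- Let N ≥ 2 and let A, B be N×N complex matrices such that the product A·B* has rank one, with unique nonzero eigenvalue v² ∈ ℂ (equivalently, the characteristic polynomial of A·B* is x^{N−1}(x − v²) with v² ≠ 0, or v² = Tr(A·B*)). Then the Haar-average ∫_{U(N)} exp( Tr(A·U) + Tr(U*·B*) ) dμ_N(U) = (N−1)! · Σ_{j=0}^∞ (v²)^j / ( j! · (N−1+j)! ), which equals (N−1)·∫_0^1 (1−t)^{N−2} I_0(2√(t·v²)) dt, where I_0(z) = Σ_{j=0}^∞ z^{2j}/(4^j (j!)²) is the modified Bessel function. -/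
open MeasureTheory Matrix Finset Polynomial

/-- The modified Bessel function `I_0(z) = Σ_{j≥0} z^{2j} / (4^j (j!)²)`. -/
noncomputable def I0 (z : ℂ) : ℂ :=
  ∑' j : ℕ, z ^ (2 * j) / ((4 : ℂ) ^ j * ((j.factorial : ℂ)) ^ 2)

section HaarAverages

attribute [local instance] Matrix.normedAddCommGroup Matrix.normedSpace

section Regularity

variable {E : Type*} [NormedAddCommGroup E] [NormedSpace ℂ E] {n : Type*} [Fintype n]

theorem contDiff_matrix_of_entries {f : E → Matrix n n ℂ}
    (hf : ∀ i j, ContDiff ℂ 1 fun x => f x i j) : ContDiff ℂ 1 f :=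
  contDiff_pi.2 fun i => contDiff_pi.2 fun j => hf i j

theorem ContDiff.matrix_entry {f : E → Matrix n n ℂ} (hf : ContDiff ℂ 1 f) (i j : n) :
    ContDiff ℂ 1 fun x => f x i j :=
  contDiff_pi.1 (contDiff_pi.1 hf i) j

theorem ContDiff.matrix_mul {f g : E → Matrix n n ℂ} (hf : ContDiff ℂ 1 f)
    (hg : ContDiff ℂ 1 g) : ContDiff ℂ 1 fun x => f x * g x :=
  contDiff_matrix_of_entries fun i j => by
    simp only [Matrix.mul_apply]
    exact ContDiff.sum fun k _ => (hf.matrix_entry i k).mul (hg.matrix_entry k j)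

theorem ContDiff.matrix_trace {f : E → Matrix n n ℂ} (hf : ContDiff ℂ 1 f) :
    ContDiff ℂ 1 fun x => (f x).trace :=
  ContDiff.sum fun k _ => hf.matrix_entry k k

theorem hasDerivAt_integral_of_contDiff {G : Type*} [TopologicalSpace G] [CompactSpace G]
    [MeasurableSpace G] [OpensMeasurableSpace G] (μ : Measure G) [IsFiniteMeasure μ]
    {F : ℂ × E → ℂ} (hF : ContDiff ℂ 1 F) {φ : G → E} (hφ : Continuous φ) (s₀ : ℂ) :
    HasDerivAt (fun s => ∫ x, F (s, φ x) ∂μ)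
      (∫ x, deriv (fun s => F (s, φ x)) s₀ ∂μ) s₀ := by
  have hd : ∀ s x, HasDerivAt (fun s => F (s, φ x)) (fderiv ℂ F (s, φ x) (1, 0)) s := by
    intro s x
    have h1 : HasDerivAt (fun s : ℂ => (s, φ x)) ((1 : ℂ), (0 : E)) s :=
      (hasDerivAt_id s).prodMk (hasDerivAt_const s _)
    exact ((hF.differentiable one_ne_zero (s, φ x)).hasFDerivAt).comp_hasDerivAt s h1
  have hc' : Continuous fun p : ℂ × G => fderiv ℂ F (p.1, φ p.2) (1, 0) :=
    ((hF.continuous_fderiv one_ne_zero).comp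
      (continuous_fst.prodMk (hφ.comp continuous_snd))).clm_apply continuous_const
  have hint : ∀ f : G → ℂ, Continuous f → Integrable f μ := fun f hf =>
    hf.integrable_of_hasCompactSupport (HasCompactSupport.of_compactSpace f)
  have hFc : ∀ s, Continuous fun x => F (s, φ x) := fun s =>
    hF.continuous.comp (continuous_const.prodMk hφ)
  obtain ⟨C, hC⟩ := ((isCompact_closedBall s₀ 1).prod (isCompact_univ (X := G))).exists_bound_of_continuousOn
    hc'.continuousOn
  simp only [fun x => (hd s₀ x).deriv]
  refine (hasDerivAt_integral_of_dominated_loc_of_deriv_le (bound := fun _ => C)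
    (F' := fun s x => fderiv ℂ F (s, φ x) (1, 0))
    (Metric.closedBall_mem_nhds s₀ one_pos)
    (Filter.Eventually.of_forall fun s => (hint _ (hFc s)).aestronglyMeasurable)
    (hint _ (hFc s₀))
    (hint _ (hc'.comp (continuous_const.prodMk continuous_id))).aestronglyMeasurable
    (Filter.Eventually.of_forall fun x s hs => hC (s, x) ⟨hs, Set.mem_univ _⟩)
    (integrable_const C)
    (Filter.Eventually.of_forall fun x s _ => hd s x)).2

end Regularity

section UnitaryGroup

variable {n : Type*} [Fintype n] [DecidableEq n]

instance borelSpace_matrix : BorelSpace (Matrix n n ℂ) :=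
  inferInstanceAs (BorelSpace (n → n → ℂ))

instance borelSpace_unitaryGroup : BorelSpace (Matrix.unitaryGroup n ℂ) :=
  inferInstanceAs (BorelSpace {U : Matrix n n ℂ // U ∈ Matrix.unitaryGroup n ℂ})

instance compactSpace_unitaryGroup : CompactSpace (Matrix.unitaryGroup n ℂ) := by
  refine isCompact_iff_compactSpace.1 (Metric.isCompact_of_isClosed_isBounded ?_ ?_)
  · have : (Matrix.unitaryGroup n ℂ : Set (Matrix n n ℂ)) = {U | U * star U = 1} := by
      ext U; exact Matrix.mem_unitaryGroup_iff
    rw [this]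
    exact isClosed_eq (continuous_id.matrix_mul continuous_id.matrix_conjTranspose) continuous_const
  · refine isBounded_iff_forall_norm_le.2 ⟨1, fun U hU => ?_⟩
    exact entrywise_sup_norm_bound_of_unitary hU

instance isTopologicalGroup_unitaryGroup : IsTopologicalGroup (Matrix.unitaryGroup n ℂ) :=
  inferInstanceAs (IsTopologicalGroup (unitary (Matrix n n ℂ)))

theorem integrable_unitaryGroup_of_continuous (μ : Measure (Matrix.unitaryGroup n ℂ))
    [IsFiniteMeasure μ] {f : Matrix.unitaryGroup n ℂ → ℂ} (hf : Continuous f) :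
    Integrable f μ :=
  hf.integrable_of_hasCompactSupport (HasCompactSupport.of_compactSpace f)

variable {μ : Measure (Matrix.unitaryGroup n ℂ)} [IsProbabilityMeasure μ]

theorem integral_mul_left_of_map_eq (hinv : ∀ V : Matrix.unitaryGroup n ℂ, μ.map (fun U => V * U) = μ)
    (V : Matrix.unitaryGroup n ℂ) {f : Matrix.unitaryGroup n ℂ → ℂ} (hf : Continuous f) :
    ∫ U, f (V * U) ∂μ = ∫ U, f U ∂μ := by
  conv_rhs => rw [← hinv V]
  rw [integral_map (continuous_const_mul V).measurable.aemeasurable]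
  rw [hinv V]
  exact (integrable_unitaryGroup_of_continuous μ hf).aestronglyMeasurable

theorem integral_inv_of_map_eq (hinv : ∀ V : Matrix.unitaryGroup n ℂ, μ.map (fun U => V * U) = μ)
    {f : Matrix.unitaryGroup n ℂ → ℂ} (hf : Continuous f) :
    ∫ U, f U⁻¹ ∂μ = ∫ U, f U ∂μ := by
  have hswap := integral_integral_swap_of_hasCompactSupport (μ := μ) (ν := μ)
    (f := fun V U => f (V⁻¹ * U))
    (by simp only [Function.uncurry_def]
        exact hf.comp (continuous_fst.inv.mul continuous_snd))
    (HasCompactSupport.of_compactSpace _)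
  have h1 : ∀ V, ∫ U, f (V⁻¹ * U) ∂μ = ∫ U, f U ∂μ := fun V =>
    integral_mul_left_of_map_eq hinv V⁻¹ hf
  have h2 : ∀ U, ∫ V, f (V⁻¹ * U) ∂μ = ∫ V, f V⁻¹ ∂μ := fun U => by
    rw [← integral_mul_left_of_map_eq hinv U⁻¹ (f := fun V => f V⁻¹) (hf.comp continuous_inv)]
    simp
  simp only [h1, h2] at hswap
  simpa using hswap.symm

theorem integral_mul_right_of_map_eq (hinv : ∀ V : Matrix.unitaryGroup n ℂ, μ.map (fun U => V * U) = μ)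
    (V : Matrix.unitaryGroup n ℂ) {f : Matrix.unitaryGroup n ℂ → ℂ} (hf : Continuous f) :
    ∫ U, f (U * V) ∂μ = ∫ U, f U ∂μ := by
  rw [← integral_inv_of_map_eq hinv hf,
    ← integral_mul_left_of_map_eq hinv V⁻¹ (f := fun U => f U⁻¹) (hf.comp continuous_inv),
    ← integral_inv_of_map_eq hinv (f := fun U => f (U * V)) (hf.comp (continuous_id.mul continuous_const))]
  simp

end UnitaryGroup

section GeneralLinearInvariance

variable {n : Type*} [Fintype n] [DecidableEq n]

open scoped ComplexOrder in
theorem exists_unitary_mul_diagonal_exp_mul_unitary {g g' : Matrix n n ℂ} (hg : g * g' = 1) :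
    ∃ (W Q : Matrix.unitaryGroup n ℂ) (a : n → ℝ),
      g = W * (diagonal fun i => Complex.exp (a i)) * Q ∧
      g' = star (Q : Matrix n n ℂ) * (diagonal fun i => Complex.exp (-(a i))) *
        star (W : Matrix n n ℂ) := by
  have hg' : g' * g = 1 := mul_eq_one_comm.1 hg
  have hpos : (gᴴ * g).PosDef := by
    refine Matrix.PosDef.conjTranspose_mul_self g ?_
    exact Matrix.mulVec_injective_of_isUnit (IsUnit.of_mul_eq_one g' hg)
  set Q := hpos.isHermitian.eigenvectorUnitary with hQ
  set l := hpos.isHermitian.eigenvalues with hl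
  have hspec : gᴴ * g = (Q : Matrix n n ℂ) * diagonal (fun i => (l i : ℂ)) * star (Q : Matrix n n ℂ) := by
    have := hpos.isHermitian.spectral_theorem
    rwa [Unitary.conjStarAlgAut_apply] at this
  have hQ1 : star (Q : Matrix n n ℂ) * Q = 1 := Unitary.coe_star_mul_self Q
  have hQ2 : (Q : Matrix n n ℂ) * star (Q : Matrix n n ℂ) = 1 := Unitary.coe_mul_star_self Q
  set a : n → ℝ := fun i => Real.log (l i) / 2
  have hDD : (diagonal fun i => Complex.exp (-(a i : ℂ))) * (diagonal fun i => Complex.exp (a i)) = 1 := by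
    rw [diagonal_mul_diagonal, ← diagonal_one]
    congr 1; ext i; rw [← Complex.exp_add]; simp
  have hDD' := mul_eq_one_comm.1 hDD
  have hDl : (diagonal fun i => Complex.exp (-(a i : ℂ))) * diagonal (fun i => (l i : ℂ)) *
      (diagonal fun i => Complex.exp (-(a i))) = 1 := by
    rw [diagonal_mul_diagonal, diagonal_mul_diagonal, ← diagonal_one]
    congr 1; ext i
    have h0 : 0 < l i := hpos.eigenvalues_pos i
    have : (l i : ℂ) = Complex.exp (a i) * Complex.exp (a i) := by
      rw [← Complex.exp_add, ← Complex.ofReal_add, ← Complex.ofReal_exp]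
      simp [a, Real.exp_log h0]
    rw [this, ← mul_assoc, ← Complex.exp_add, mul_assoc, ← Complex.exp_add]; simp
  set D := diagonal fun i => Complex.exp (a i : ℂ)
  set D' := diagonal fun i => Complex.exp (-(a i : ℂ))
  have hD's : D'ᴴ = D' := by
    rw [diagonal_conjTranspose]
    congr 1; ext i
    simp [← Complex.exp_conj]
  have hW : g * Q * D' ∈ Matrix.unitaryGroup n ℂ := by
    rw [Matrix.mem_unitaryGroup_iff']
    calc star (g * Q * D') * (g * Q * D')
        = D' * (star (Q : Matrix n n ℂ) * (gᴴ * g) * Q) * D' := by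
          simp only [star_eq_conjTranspose, conjTranspose_mul, hD's, mul_assoc]
      _ = D' * ((star (Q : Matrix n n ℂ) * Q) * diagonal (fun i => (l i : ℂ)) * (star (Q : Matrix n n ℂ) * Q)) * D' := by
          rw [hspec]; simp only [mul_assoc]
      _ = 1 := by rw [hQ1, one_mul, mul_one, hDl]
  have h1 : g = g * Q * D' * D * star (Q : Matrix n n ℂ) := by
    rw [mul_assoc (g * (Q : Matrix n n ℂ)), hDD, mul_one, mul_assoc, hQ2, mul_one]
  have hW1 := Matrix.mem_unitaryGroup_iff.1 hW
  refine ⟨⟨_, hW⟩, star Q, a, h1, ?_⟩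
  have h2 : g * (star (star (Q : Matrix n n ℂ)) * D' * star (g * Q * D')) = 1 := by
    rw [← hW1, star_star]; simp only [mul_assoc]
  calc g' = g' * (g * (star (star (Q : Matrix n n ℂ)) * D' * star (g * Q * D'))) := by
          rw [h2, mul_one]
    _ = _ := by rw [← mul_assoc, hg', one_mul]; rfl

theorem star_diagonal_exp_mul_I (t : ℝ) (a : n → ℝ) :
    star (diagonal fun i => Complex.exp (t * Complex.I * a i)) =
      diagonal fun i => Complex.exp (-(t * Complex.I * a i)) := by
  rw [star_eq_conjTranspose, diagonal_conjTranspose]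
  congr 1; ext i
  simp [← Complex.exp_conj]

theorem contDiff_diagonal_exp (a : n → ℂ) :
    ContDiff ℂ 1 fun p : ℂ × (Matrix n n ℂ × Matrix n n ℂ) =>
      diagonal fun i => Complex.exp (p.1 * a i) :=
  contDiff_matrix_of_entries fun i j => by
    by_cases h : i = j
    · subst h
      simp only [diagonal_apply_eq]
      fun_prop
    · simp only [diagonal_apply_ne _ h]
      exact contDiff_const

variable {μ : Measure (Matrix.unitaryGroup n ℂ)} [IsProbabilityMeasure μ]

theorem continuous_coe_prod_star :
    Continuous fun U : Matrix.unitaryGroup n ℂ => ((U : Matrix n n ℂ), star (U : Matrix n n ℂ)) :=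
  continuous_subtype_val.prodMk continuous_subtype_val.matrix_conjTranspose

/-- Unitarian trick: the invariance of Haar averages of holomorphic functions of `(U, U*)` under
right multiplication extends from the unitary group to the general linear group. -/
theorem integral_mul_right_of_mul_eq_one
    (hinv : ∀ V : Matrix.unitaryGroup n ℂ, μ.map (fun U => V * U) = μ)
    {h : Matrix n n ℂ × Matrix n n ℂ → ℂ} (hh : ContDiff ℂ 1 h)
    {g g' : Matrix n n ℂ} (hg : g * g' = 1) :
    ∫ U : Matrix.unitaryGroup n ℂ, h ((U : Matrix n n ℂ) * g, g' * star (U : Matrix n n ℂ)) ∂μ =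
      ∫ U : Matrix.unitaryGroup n ℂ, h ((U : Matrix n n ℂ), star (U : Matrix n n ℂ)) ∂μ := by
  obtain ⟨W, Q, a, rfl, rfl⟩ := exists_unitary_mul_diagonal_exp_mul_unitary hg
  let F : ℂ × (Matrix n n ℂ × Matrix n n ℂ) → ℂ := fun p =>
    h (p.2.1 * (W * (diagonal fun i => Complex.exp (p.1 * a i)) * Q),
      star (Q : Matrix n n ℂ) * (diagonal fun i => Complex.exp (p.1 * (-(a i)))) *
        star (W : Matrix n n ℂ) * p.2.2)
  have hF : ContDiff ℂ 1 F := by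
    refine hh.comp (ContDiff.prodMk ?_ ?_)
    · exact contDiff_snd.fst.matrix_mul
        ((contDiff_const.matrix_mul (contDiff_diagonal_exp _)).matrix_mul contDiff_const)
    · exact ((contDiff_const.matrix_mul (contDiff_diagonal_exp fun i => -(a i : ℂ))).matrix_mul
        contDiff_const).matrix_mul contDiff_snd.snd
  let f : ℂ → ℂ := fun s =>
    ∫ U : Matrix.unitaryGroup n ℂ, F (s, ((U : Matrix n n ℂ), star (U : Matrix n n ℂ))) ∂μ
  have hf : Differentiable ℂ f := fun s =>
    (hasDerivAt_integral_of_contDiff μ hF continuous_coe_prod_star s).differentiableAt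
  set c := ∫ U : Matrix.unitaryGroup n ℂ, h ((U : Matrix n n ℂ), star (U : Matrix n n ℂ)) ∂μ with hc
  have hunit : ∀ t : ℝ, f (t * Complex.I) = c := by
    intro t
    have hD : (diagonal fun i => Complex.exp (t * Complex.I * a i)) ∈ Matrix.unitaryGroup n ℂ := by
      rw [Matrix.mem_unitaryGroup_iff, star_diagonal_exp_mul_I, diagonal_mul_diagonal,
        ← diagonal_one]
      congr 1; ext i; rw [← Complex.exp_add]; simp
    have := integral_mul_right_of_map_eq hinv (W * ⟨_, hD⟩ * Q)
      (f := fun U => h ((U : Matrix n n ℂ), star (U : Matrix n n ℂ)))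
      (hh.continuous.comp continuous_coe_prod_star)
    rw [hc, ← this]
    refine integral_congr_ae (Filter.Eventually.of_forall fun U => ?_)
    simp only [F, Submonoid.coe_mul, star_mul, star_diagonal_exp_mul_I, mul_neg]
    simp only [mul_assoc]
  have hconst : f = fun _ => c := by
    refine AnalyticOnNhd.eq_of_frequently_eq (𝕜 := ℂ) (z₀ := 0)
      (fun z _ => hf.analyticAt z) (fun z _ => analyticAt_const) ?_
    have htend : Filter.Tendsto (fun t : ℝ => (t : ℂ) * Complex.I) (nhdsWithin 0 {0}ᶜ)
        (nhdsWithin 0 {0}ᶜ) := by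
      refine tendsto_nhdsWithin_iff.2 ⟨?_, ?_⟩
      · have : Continuous fun t : ℝ => (t : ℂ) * Complex.I := by fun_prop
        exact (this.tendsto' 0 0 (by simp)).mono_left nhdsWithin_le_nhds
      · filter_upwards [self_mem_nhdsWithin] with t ht
        simpa using ht
    exact htend.frequently (Filter.Frequently.of_forall hunit)
  have := congrFun hconst 1
  simpa [f, F] using this

theorem integral_mul_left_of_mul_eq_one
    (hinv : ∀ V : Matrix.unitaryGroup n ℂ, μ.map (fun U => V * U) = μ)
    {h : Matrix n n ℂ × Matrix n n ℂ → ℂ} (hh : ContDiff ℂ 1 h)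
    {g g' : Matrix n n ℂ} (hg : g * g' = 1) :
    ∫ U : Matrix.unitaryGroup n ℂ, h (g * (U : Matrix n n ℂ), star (U : Matrix n n ℂ) * g') ∂μ =
      ∫ U : Matrix.unitaryGroup n ℂ, h ((U : Matrix n n ℂ), star (U : Matrix n n ℂ)) ∂μ := by
  have hswap : ContDiff ℂ 1 fun p : Matrix n n ℂ × Matrix n n ℂ => h (p.2, p.1) :=
    hh.comp (contDiff_snd.prodMk contDiff_fst)
  have hmul : ContDiff ℂ 1 fun p : Matrix n n ℂ × Matrix n n ℂ => h (g * p.1, p.2 * g') :=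
    hh.comp ((contDiff_const.matrix_mul contDiff_fst).prodMk
      (contDiff_snd.matrix_mul contDiff_const))
  have h1 := integral_inv_of_map_eq hinv
    (f := fun U => h ((U : Matrix n n ℂ), star (U : Matrix n n ℂ)))
    (hh.continuous.comp continuous_coe_prod_star)
  have h2 := integral_inv_of_map_eq hinv
    (f := fun U => h (g * (U : Matrix n n ℂ), star (U : Matrix n n ℂ) * g'))
    (hmul.continuous.comp continuous_coe_prod_star)
  rw [← h1, ← h2]
  simpa using integral_mul_right_of_mul_eq_one hinv hswap (mul_eq_one_comm.1 hg)

end GeneralLinearInvariance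

section Moments

variable {n : Type*} [Fintype n] [DecidableEq n]
  {μ : Measure (Matrix.unitaryGroup n ℂ)} [IsProbabilityMeasure μ]

theorem contDiff_fst_entry (i j : n) :
    ContDiff ℂ 1 fun p : Matrix n n ℂ × Matrix n n ℂ => p.1 i j :=
  contDiff_fst.matrix_entry i j

theorem contDiff_snd_entry (i j : n) :
    ContDiff ℂ 1 fun p : Matrix n n ℂ × Matrix n n ℂ => p.2 i j :=
  contDiff_snd.matrix_entry i j

theorem continuous_unitaryGroup_entry (i j : n) :
    Continuous fun U : Matrix.unitaryGroup n ℂ => (U : Matrix n n ℂ) i j :=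
  (contDiff_fst_entry i j).continuous.comp continuous_coe_prod_star

theorem continuous_unitaryGroup_star_entry (i j : n) :
    Continuous fun U : Matrix.unitaryGroup n ℂ => star (U : Matrix n n ℂ) i j :=
  (contDiff_snd_entry i j).continuous.comp continuous_coe_prod_star

theorem integrable_entry_moment (o : n) (j : ℕ) :
    Integrable (fun U : Matrix.unitaryGroup n ℂ =>
      (U : Matrix n n ℂ) o o ^ j * star (U : Matrix n n ℂ) o o ^ j) μ :=
  integrable_unitaryGroup_of_continuous μ
    (((continuous_unitaryGroup_entry o o).pow _).mul
      ((continuous_unitaryGroup_star_entry o o).pow _))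

theorem integrable_mixed_moment (o k : n) (j : ℕ) :
    Integrable (fun U : Matrix.unitaryGroup n ℂ =>
      (U : Matrix n n ℂ) o o ^ j * star (U : Matrix n n ℂ) o o ^ j *
        ((U : Matrix n n ℂ) o k * star (U : Matrix n n ℂ) k o)) μ :=
  integrable_unitaryGroup_of_continuous μ
    ((((continuous_unitaryGroup_entry o o).pow _).mul
      ((continuous_unitaryGroup_star_entry o o).pow _)).mul
      ((continuous_unitaryGroup_entry o k).mul (continuous_unitaryGroup_star_entry k o)))

theorem integral_entry_pow_mul_star_entry_pow_of_ne
    (hinv : ∀ V : Matrix.unitaryGroup n ℂ, μ.map (fun U => V * U) = μ) (o : n)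
    {j k : ℕ} (hjk : j ≠ k) :
    ∫ U : Matrix.unitaryGroup n ℂ,
      (U : Matrix n n ℂ) o o ^ j * star (U : Matrix n n ℂ) o o ^ k ∂μ = 0 := by
  have hg : ((2 : ℂ) • (1 : Matrix n n ℂ)) * ((2 : ℂ)⁻¹ • (1 : Matrix n n ℂ)) = 1 := by
    simp [smul_smul]
  have h := integral_mul_right_of_mul_eq_one hinv
    (((contDiff_fst_entry o o).pow j).mul ((contDiff_snd_entry o o).pow k)) hg
  simp only [Matrix.mul_smul, mul_one, Matrix.smul_mul, one_mul, Matrix.smul_apply, smul_eq_mul,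
    mul_pow, inv_pow] at h
  simp only [mul_mul_mul_comm _ _ (((2 : ℂ) ^ k)⁻¹)] at h
  rw [integral_const_mul] at h
  have h2 : (2 : ℂ) ^ j * (2 ^ k)⁻¹ ≠ 1 := by
    rw [← div_eq_mul_inv, Ne, div_eq_one_iff_eq (pow_ne_zero _ two_ne_zero)]
    exact_mod_cast fun h => hjk (Nat.pow_right_injective le_rfl h)
  by_contra h0
  exact h2 (mul_right_cancel₀ h0 (h.trans (one_mul _).symm))

theorem succ_mul_integral_mixed_moment
    (hinv : ∀ V : Matrix.unitaryGroup n ℂ, μ.map (fun U => V * U) = μ) {o k : n} (hk : k ≠ o)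
    (j : ℕ) :
    ((j : ℂ) + 1) * ∫ U : Matrix.unitaryGroup n ℂ,
      (U : Matrix n n ℂ) o o ^ j * star (U : Matrix n n ℂ) o o ^ j *
        ((U : Matrix n n ℂ) o k * star (U : Matrix n n ℂ) k o) ∂μ =
    ∫ U : Matrix.unitaryGroup n ℂ,
      (U : Matrix n n ℂ) o o ^ (j + 1) * star (U : Matrix n n ℂ) o o ^ (j + 1) ∂μ := by
  let F : ℂ × (Matrix n n ℂ × Matrix n n ℂ) → ℂ := fun p =>
    (p.2.1 o o - p.1 * p.2.1 o k) ^ (j + 1) *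
      (p.2.2 o o ^ j * (p.2.2 k o + p.1 * p.2.2 o o))
  have hF : ContDiff ℂ 1 F := by
    have h1 : ∀ i j, ContDiff ℂ 1 fun p : ℂ × (Matrix n n ℂ × Matrix n n ℂ) => p.2.1 i j :=
      fun i j => (contDiff_fst_entry i j).comp contDiff_snd
    have h2 : ∀ i j, ContDiff ℂ 1 fun p : ℂ × (Matrix n n ℂ × Matrix n n ℂ) => p.2.2 i j :=
      fun i j => (contDiff_snd_entry i j).comp contDiff_snd
    exact (((h1 o o).sub (contDiff_fst.mul (h1 o k))).pow _).mul
      (((h2 o o).pow _).mul ((h2 k o).add (contDiff_fst.mul (h2 o o))))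
  have hconst : ∀ s : ℂ, ∫ U : Matrix.unitaryGroup n ℂ,
      F (s, ((U : Matrix n n ℂ), star (U : Matrix n n ℂ))) ∂μ =
      ∫ U : Matrix.unitaryGroup n ℂ, (U : Matrix n n ℂ) o o ^ (j + 1) *
        (star (U : Matrix n n ℂ) o o ^ j * star (U : Matrix n n ℂ) k o) ∂μ := by
    intro s
    have hg : Matrix.transvection k o (-s) * Matrix.transvection k o s = 1 := by
      rw [Matrix.transvection_mul_transvection_same _ _ hk]; simp
    rw [← integral_mul_right_of_mul_eq_one hinv (((contDiff_fst_entry o o).pow (j + 1)).mul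
      (((contDiff_snd_entry o o).pow j).mul (contDiff_snd_entry k o))) hg]
    refine integral_congr_ae (Filter.Eventually.of_forall fun U => ?_)
    simp [F, Matrix.mul_transvection_apply_same, Matrix.transvection_mul_apply_same,
      Matrix.transvection_mul_apply_of_ne _ _ _ _ hk.symm, sub_eq_add_neg]
  have hderiv := hasDerivAt_integral_of_contDiff μ hF continuous_coe_prod_star 0
  simp only [hconst] at hderiv
  have hzero := hderiv.unique (hasDerivAt_const _ _)
  have hpt : ∀ U : Matrix.unitaryGroup n ℂ,
      deriv (fun s => F (s, ((U : Matrix n n ℂ), star (U : Matrix n n ℂ)))) 0 =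
      (U : Matrix n n ℂ) o o ^ (j + 1) * star (U : Matrix n n ℂ) o o ^ (j + 1) -
      ((j : ℂ) + 1) * ((U : Matrix n n ℂ) o o ^ j * star (U : Matrix n n ℂ) o o ^ j *
        ((U : Matrix n n ℂ) o k * star (U : Matrix n n ℂ) k o)) := by
    intro U
    generalize (U : Matrix n n ℂ) = X
    have h1 : HasDerivAt (fun s : ℂ => X o o - s * X o k) (-X o k) 0 := by
      simpa using ((hasDerivAt_id (0 : ℂ)).mul_const (X o k)).const_sub (X o o)
    have h2 : HasDerivAt (fun s : ℂ => star X k o + s * star X o o) (star X o o) 0 := by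
      simpa using ((hasDerivAt_id (0 : ℂ)).mul_const (star X o o)).const_add (star X k o)
    refine ((h1.pow (j + 1)).mul (h2.const_mul (star X o o ^ j))).deriv.trans ?_
    simp
    ring
  simp only [hpt] at hzero
  rw [integral_sub (integrable_entry_moment o (j + 1))
    ((integrable_mixed_moment o k j).const_mul _), integral_const_mul] at hzero
  exact (sub_eq_zero.1 hzero).symm

theorem integral_entry_moment_recurrence
    (hinv : ∀ V : Matrix.unitaryGroup n ℂ, μ.map (fun U => V * U) = μ) (o : n) (j : ℕ) :
    ((j : ℂ) + Fintype.card n) * ∫ U : Matrix.unitaryGroup n ℂ,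
      (U : Matrix n n ℂ) o o ^ (j + 1) * star (U : Matrix n n ℂ) o o ^ (j + 1) ∂μ =
    ((j : ℂ) + 1) * ∫ U : Matrix.unitaryGroup n ℂ,
      (U : Matrix n n ℂ) o o ^ j * star (U : Matrix n n ℂ) o o ^ j ∂μ := by
  have hsum : ∫ U : Matrix.unitaryGroup n ℂ,
      (U : Matrix n n ℂ) o o ^ j * star (U : Matrix n n ℂ) o o ^ j ∂μ =
      ∑ k, ∫ U : Matrix.unitaryGroup n ℂ,
      (U : Matrix n n ℂ) o o ^ j * star (U : Matrix n n ℂ) o o ^ j *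
        ((U : Matrix n n ℂ) o k * star (U : Matrix n n ℂ) k o) ∂μ := by
    rw [← integral_finsetSum _ fun k _ => integrable_mixed_moment o k j]
    refine integral_congr_ae (Filter.Eventually.of_forall fun U => ?_)
    simp only [← Finset.mul_sum]
    rw [← Matrix.mul_apply, Matrix.mem_unitaryGroup_iff.1 U.2]
    simp
  rw [hsum, Finset.mul_sum, ← Finset.add_sum_erase _ _ (Finset.mem_univ o),
    Finset.sum_congr rfl fun k hk =>
      succ_mul_integral_mixed_moment hinv (Finset.ne_of_mem_erase hk) j]
  have hcard : ((Fintype.card n - 1 : ℕ) : ℂ) = Fintype.card n - 1 := by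
    have : 0 < Fintype.card n := Fintype.card_pos_iff.2 ⟨o⟩
    push_cast [Nat.cast_sub this]; rfl
  simp only [Finset.sum_const, Finset.card_erase_of_mem (Finset.mem_univ o), Finset.card_univ,
    nsmul_eq_mul, hcard]
  have hdiag : ∀ U : Matrix.unitaryGroup n ℂ,
      (U : Matrix n n ℂ) o o ^ j * star (U : Matrix n n ℂ) o o ^ j *
        ((U : Matrix n n ℂ) o o * star (U : Matrix n n ℂ) o o) =
      (U : Matrix n n ℂ) o o ^ (j + 1) * star (U : Matrix n n ℂ) o o ^ (j + 1) := fun U => by ring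
  simp only [hdiag]
  ring

theorem integral_entry_moment
    (hinv : ∀ V : Matrix.unitaryGroup n ℂ, μ.map (fun U => V * U) = μ) (o : n) (j : ℕ) :
    ∫ U : Matrix.unitaryGroup n ℂ,
      (U : Matrix n n ℂ) o o ^ j * star (U : Matrix n n ℂ) o o ^ j ∂μ =
    (j.factorial : ℂ) * (Fintype.card n - 1).factorial / (Fintype.card n - 1 + j).factorial := by
  induction j with
  | zero =>
    have := Nat.cast_ne_zero (R := ℂ).2 (Nat.factorial_ne_zero (Fintype.card n - 1))
    simp [this]
  | succ j ih =>
    have hrec := integral_entry_moment_recurrence hinv o j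
    obtain ⟨d, hd⟩ : ∃ d, Fintype.card n = d + 1 :=
      Nat.exists_eq_succ_of_ne_zero (Fintype.card_pos_iff.2 ⟨o⟩).ne'
    rw [ih, hd] at hrec
    rw [hd]
    simp only [Nat.add_sub_cancel] at hrec ⊢
    have h1 : ((d + j).factorial : ℂ) ≠ 0 := Nat.cast_ne_zero.2 (Nat.factorial_ne_zero _)
    have h2 : (j : ℂ) + ((d + 1 : ℕ) : ℂ) ≠ 0 := by exact_mod_cast (by omega : j + (d + 1) ≠ 0)
    apply mul_left_cancel₀ h2
    rw [hrec, ← add_assoc d j 1, Nat.factorial_succ, Nat.factorial_succ]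
    have h3 : ((d : ℂ) + j + 1) ≠ 0 := by push_cast at h2; convert h2 using 1; ring
    push_cast
    field_simp
    ring

theorem hasSum_inv_factorial_mul_pow (w : ℂ) :
    HasSum (fun j : ℕ => (j.factorial : ℂ)⁻¹ * w ^ j) (Complex.exp w) := by
  rw [Complex.exp_eq_exp_ℂ]
  exact NormedSpace.exp_series_hasSum_exp' (𝕂 := ℂ) w

theorem HasSum.mul_exp_add {f g : ℕ → ℂ} {x y : ℂ} (hf : HasSum f (Complex.exp x))
    (hg : HasSum g (Complex.exp y)) :
    HasSum (fun p : ℕ × ℕ => f p.1 * g p.2) (Complex.exp (x + y)) := by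
  rw [Complex.exp_add]
  exact hf.mul hg (summable_mul_of_summable_norm hf.summable.norm hg.summable.norm)

theorem hasSum_integral_exp_entry
    (hinv : ∀ V : Matrix.unitaryGroup n ℂ, μ.map (fun U => V * U) = μ) (o : n) (z : ℂ) :
    HasSum (fun j : ℕ => ((Fintype.card n - 1).factorial : ℂ) *
        (z ^ j / ((j.factorial : ℂ) * (Fintype.card n - 1 + j).factorial)))
      (∫ U : Matrix.unitaryGroup n ℂ,
        Complex.exp ((U : Matrix n n ℂ) o o + z * star (U : Matrix n n ℂ) o o) ∂μ) := by
  let T : ℕ × ℕ → Matrix.unitaryGroup n ℂ → ℂ := fun p U =>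
    ((p.1.factorial : ℂ)⁻¹ * ((p.2.factorial : ℂ)⁻¹ * z ^ p.2)) *
      ((U : Matrix n n ℂ) o o ^ p.1 * star (U : Matrix n n ℂ) o o ^ p.2)
  have hT : ∀ p, Continuous (T p) := fun p => continuous_const.mul
    (((continuous_unitaryGroup_entry o o).pow _).mul
      ((continuous_unitaryGroup_star_entry o o).pow _))
  have hpt : ∀ U, HasSum (fun p => T p U)
      (Complex.exp ((U : Matrix n n ℂ) o o + z * star (U : Matrix n n ℂ) o o)) := by
    intro U
    have := (hasSum_inv_factorial_mul_pow ((U : Matrix n n ℂ) o o)).mul_exp_add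
      (hasSum_inv_factorial_mul_pow (z * star (U : Matrix n n ℂ) o o))
    convert this using 2 with p
    simp only [T, mul_pow]
    ring
  have hbound : ∀ p U, ‖T p U‖ ≤ ((p.1.factorial : ℝ)⁻¹ * 1 ^ p.1) *
      ((p.2.factorial : ℝ)⁻¹ * ‖z‖ ^ p.2) := by
    intro p U
    have h1 : ‖(U : Matrix n n ℂ) o o‖ ≤ 1 := entry_norm_bound_of_unitary U.2 o o
    have h2 : ‖star (U : Matrix n n ℂ) o o‖ ≤ 1 := by simpa using h1
    simp only [T, norm_mul, norm_inv, norm_pow, Complex.norm_natCast, one_pow, mul_one]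
    exact mul_le_of_le_one_right (by positivity)
      (mul_le_one₀ (pow_le_one₀ (norm_nonneg _) h1) (by positivity) (pow_le_one₀ (norm_nonneg _) h2))
  have hsumR : ∀ r : ℝ, Summable fun j : ℕ => (j.factorial : ℝ)⁻¹ * r ^ j := fun r => by
    simpa using NormedSpace.expSeries_summable' (𝕂 := ℝ) r
  have hsum := hasSum_integral_of_dominated_convergence (μ := μ) (F := T)
    (fun p _ => ((p.1.factorial : ℝ)⁻¹ * 1 ^ p.1) * ((p.2.factorial : ℝ)⁻¹ * ‖z‖ ^ p.2))
    (fun p => (integrable_unitaryGroup_of_continuous μ (hT p)).aestronglyMeasurable)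
    (fun p => Filter.Eventually.of_forall (hbound p))
    (Filter.Eventually.of_forall fun _ => (hsumR 1).mul_of_nonneg (hsumR ‖z‖)
      (fun j => by positivity) (fun j => by positivity))
    (integrable_const _) (Filter.Eventually.of_forall hpt)
  have hinj : Function.Injective fun j : ℕ => (j, j) := fun a b h => (Prod.mk.inj h).1
  rw [← hinj.hasSum_iff] at hsum
  · refine hsum.congr_fun fun j => ?_
    simp only [T, Function.comp]
    rw [integral_const_mul, integral_entry_moment hinv]
    have h1 : ((j).factorial : ℂ) ≠ 0 := Nat.cast_ne_zero.2 (Nat.factorial_ne_zero _)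
    field_simp
  · rintro ⟨j, k⟩ hp
    have hjk : j ≠ k := fun h => hp ⟨j, by simp [h]⟩
    simp only [T]
    rw [integral_const_mul, integral_entry_pow_mul_star_entry_pow_of_ne hinv o hjk, mul_zero]

end Moments

section Reduction

variable {n : Type*} [Fintype n] [DecidableEq n]

theorem Matrix.exists_eq_vecMulVec_of_rank_eq_one {K : Type*} [Field K] {M : Matrix n n K}
    (hM : M.rank = 1) : ∃ u w : n → K, M = vecMulVec u w := by
  obtain ⟨u, -, hu⟩ := finrank_eq_one_iff'.1 hM
  choose c hc using fun j => hu ⟨M *ᵥ Pi.single j 1, LinearMap.mem_range_self M.mulVecLin _⟩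
  refine ⟨u, c, ?_⟩
  ext i j
  have := congrFun (congrArg Subtype.val (hc j)) i
  simp only [mulVec_single_one, col_apply, SetLike.val_smul, Pi.smul_apply, smul_eq_mul] at this
  rw [vecMulVec_apply, ← this, mul_comm]

theorem Matrix.exists_eq_conj_single_of_dotProduct_ne_zero {K : Type*} [Field K] {u w : n → K}
    (huw : u ⬝ᵥ w ≠ 0) :
    ∃ (o : n) (g g' : Matrix n n K), g * g' = 1 ∧
      vecMulVec u w = g' * Matrix.single o o (u ⬝ᵥ w) * g := by
  obtain ⟨o, -, ho⟩ := Finset.exists_ne_zero_of_sum_ne_zero huw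
  have huo : u o ≠ 0 := left_ne_zero_of_mul ho
  set v := u ⬝ᵥ w with hv
  let g : Matrix n n K := Matrix.of fun i k =>
    if i = o then w k else (1 : Matrix n n K) i k - u i / u o * (1 : Matrix n n K) o k
  let g' : Matrix n n K := Matrix.of fun k j =>
    if j = o then u k / v else (1 : Matrix n n K) k j - w j * (u k / v)
  have hwu : ∑ k, w k * (u k / v) = 1 := by
    simp only [mul_div_assoc', ← Finset.sum_div]
    rw [div_eq_one_iff_eq huw, hv, dotProduct]
    exact Finset.sum_congr rfl fun k _ => mul_comm _ _
  refine ⟨o, g, g', ?_, ?_⟩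
  · have hrow : ∀ j, (g * g') o j = ∑ k, w k * g' k j := fun j => by
      rw [Matrix.mul_apply]; simp [g]
    have hrow' : ∀ i j, i ≠ o → (g * g') i j = g' i j - u i / u o * g' o j := fun i j hi => by
      rw [Matrix.mul_apply]
      simp [g, hi, sub_mul, Matrix.one_apply, Finset.sum_sub_distrib]
    ext i j
    by_cases hi : i = o
    · subst hi
      rw [hrow]
      by_cases hj : j = i
      · subst hj
        simpa [g'] using hwu
      · simp only [g', of_apply, hj, if_false, mul_sub, Finset.sum_sub_distrib, mul_left_comm _ (w j),
          ← Finset.mul_sum, hwu]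
        simp [Matrix.one_apply, Ne.symm hj]
    · rw [hrow' i j hi]
      by_cases hj : j = o
      · subst hj
        simp only [g', of_apply, if_true, Matrix.one_apply_ne hi]
        field_simp
        ring
      · simp only [g', of_apply, hj, if_false, Matrix.one_apply_ne (Ne.symm hj)]
        field_simp
        ring
  · ext i j
    rw [Matrix.mul_assoc, Matrix.mul_apply, Finset.sum_eq_single o]
    · simp [g, g', vecMulVec_apply]
      field_simp
    · intro k _ hk
      simp [Matrix.single_mul_apply_of_ne _ _ _ _ _ hk]
    · simp

theorem Matrix.trace_eq_of_charpoly_eq {R : Type*} [CommRing R] [Nontrivial R] [Nonempty n]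
    {M : Matrix n n R} {v : R} (h : M.charpoly = X ^ (Fintype.card n - 1) * (X - C v)) :
    M.trace = v := by
  rw [Matrix.trace_eq_neg_charpoly_coeff, h, coeff_X_pow_mul']
  simp

/-- The external field integral `∫ exp (Tr (A U) + Tr (U* C)) dμ(U)`. -/
noncomputable def externalFieldIntegral (μ : Measure (Matrix.unitaryGroup n ℂ))
    (A C : Matrix n n ℂ) : ℂ :=
  ∫ U : Matrix.unitaryGroup n ℂ, Complex.exp (Matrix.trace (A * (U : Matrix n n ℂ)) +
    Matrix.trace (star (U : Matrix n n ℂ) * C)) ∂μ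

variable {μ : Measure (Matrix.unitaryGroup n ℂ)} [IsProbabilityMeasure μ]

theorem contDiff_exp_trace_add_trace (A C : Matrix n n ℂ) :
    ContDiff ℂ 1 fun p : Matrix n n ℂ × Matrix n n ℂ =>
      Complex.exp (Matrix.trace (A * p.1) + Matrix.trace (p.2 * C)) :=
  ((contDiff_const.matrix_mul contDiff_fst).matrix_trace.add
    (contDiff_snd.matrix_mul contDiff_const).matrix_trace).cexp

theorem externalFieldIntegral_mul_left
    (hinv : ∀ V : Matrix.unitaryGroup n ℂ, μ.map (fun U => V * U) = μ) (A C : Matrix n n ℂ)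
    {g g' : Matrix n n ℂ} (hg : g * g' = 1) :
    externalFieldIntegral μ (g * A) (C * g') = externalFieldIntegral μ A C := by
  rw [externalFieldIntegral, externalFieldIntegral,
    ← integral_mul_right_of_mul_eq_one hinv (contDiff_exp_trace_add_trace A C) hg]
  refine integral_congr_ae (Filter.Eventually.of_forall fun U => ?_)
  simp only
  rw [mul_assoc g, Matrix.trace_mul_comm g, mul_assoc A, mul_assoc g', Matrix.trace_mul_comm g',
    mul_assoc _ C]

theorem externalFieldIntegral_mul_right
    (hinv : ∀ V : Matrix.unitaryGroup n ℂ, μ.map (fun U => V * U) = μ) (A C : Matrix n n ℂ)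
    {g g' : Matrix n n ℂ} (hg : g * g' = 1) :
    externalFieldIntegral μ (A * g) (g' * C) = externalFieldIntegral μ A C := by
  rw [externalFieldIntegral, externalFieldIntegral,
    ← integral_mul_left_of_mul_eq_one hinv (contDiff_exp_trace_add_trace A C) hg]
  simp only [mul_assoc]

theorem continuous_externalFieldIntegral_comp {f₁ f₂ : ℂ → Matrix n n ℂ}
    (h₁ : ContDiff ℂ 1 f₁) (h₂ : ContDiff ℂ 1 f₂) :
    Continuous fun s => externalFieldIntegral μ (f₁ s) (f₂ s) := by
  have hF : ContDiff ℂ 1 fun p : ℂ × (Matrix n n ℂ × Matrix n n ℂ) =>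
      Complex.exp (Matrix.trace (f₁ p.1 * p.2.1) + Matrix.trace (p.2.2 * f₂ p.1)) :=
    (((h₁.comp contDiff_fst).matrix_mul contDiff_snd.fst).matrix_trace.add
      (contDiff_snd.snd.matrix_mul (h₂.comp contDiff_fst)).matrix_trace).cexp
  exact continuous_iff_continuousAt.2 fun s =>
    (hasDerivAt_integral_of_contDiff μ hF continuous_coe_prod_star s).continuousAt

theorem Matrix.eventually_det_add_smul_one_ne_zero (A : Matrix n n ℂ) :
    ∀ᶠ s : ℂ in nhdsWithin 0 {0}ᶜ, (A + s • (1 : Matrix n n ℂ)).det ≠ 0 := by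
  have hfin : {s : ℂ | (-A).charpoly.IsRoot s}.Finite :=
    Polynomial.finite_setOfPred_isRoot (Matrix.charpoly_monic _).ne_zero
  have : ∀ᶠ s : ℂ in nhdsWithin 0 {0}ᶜ, s ∈ ({s : ℂ | (-A).charpoly.IsRoot s} \ {0})ᶜ :=
    nhdsWithin_le_nhds ((hfin.subset Set.sdiff_subset).isClosed.isOpen_compl.mem_nhds (by simp))
  filter_upwards [this, self_mem_nhdsWithin] with s hs hs0 hdet
  refine hs ⟨?_, hs0⟩
  change (-A).charpoly.eval s = 0
  rw [Matrix.eval_charpoly, ← hdet]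
  congr 1
  rw [Matrix.scalar_apply, ← Matrix.smul_one_eq_diagonal]
  abel

theorem externalFieldIntegral_eq_one_mul
    (hinv : ∀ V : Matrix.unitaryGroup n ℂ, μ.map (fun U => V * U) = μ) (A C : Matrix n n ℂ) :
    externalFieldIntegral μ A C = externalFieldIntegral μ 1 (A * C) := by
  have hlin : ContDiff ℂ 1 fun s : ℂ => A + s • (1 : Matrix n n ℂ) :=
    contDiff_const.add (contDiff_id.smul contDiff_const)
  have hL := (continuous_externalFieldIntegral_comp (μ := μ) hlin
    (contDiff_const (c := C))).tendsto' 0 (externalFieldIntegral μ A C) (by simp)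
  have hR := (continuous_externalFieldIntegral_comp (μ := μ) (contDiff_const (c := 1))
    (hlin.matrix_mul (contDiff_const (c := C)))).tendsto' 0
      (externalFieldIntegral μ 1 (A * C)) (by simp)
  refine tendsto_nhds_unique_of_eventuallyEq (hL.mono_left nhdsWithin_le_nhds)
    (hR.mono_left (nhdsWithin_le_nhds (s := {0}ᶜ))) ?_
  filter_upwards [A.eventually_det_add_smul_one_ne_zero] with s hs
  have hdet : IsUnit (A + s • (1 : Matrix n n ℂ)).det := isUnit_iff_ne_zero.2 hs
  rw [← externalFieldIntegral_mul_right hinv _ _ (Matrix.nonsing_inv_mul _ hdet),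
    Matrix.mul_nonsing_inv _ hdet]

theorem hasSum_externalFieldIntegral_of_eq_vecMulVec
    (hinv : ∀ V : Matrix.unitaryGroup n ℂ, μ.map (fun U => V * U) = μ) {A C : Matrix n n ℂ}
    {u w : n → ℂ} (hAC : A * C = vecMulVec u w) (huw : u ⬝ᵥ w ≠ 0) :
    HasSum (fun j : ℕ => ((Fintype.card n - 1).factorial : ℂ) *
        ((u ⬝ᵥ w) ^ j / ((j.factorial : ℂ) * (Fintype.card n - 1 + j).factorial)))
      (externalFieldIntegral μ A C) := by
  obtain ⟨o, g, g', hg, hM⟩ := exists_eq_conj_single_of_dotProduct_ne_zero huw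
  set v := u ⬝ᵥ w
  have hconj : g * (A * C * g') = Matrix.single o o 1 * Matrix.single o o v := by
    rw [hAC, hM]
    calc g * (g' * Matrix.single o o v * g * g')
        = g * g' * Matrix.single o o v * (g * g') := by simp only [mul_assoc]
      _ = _ := by rw [hg]; simp
  rw [externalFieldIntegral_eq_one_mul hinv, ← externalFieldIntegral_mul_left hinv _ _ hg, mul_one,
    externalFieldIntegral_eq_one_mul hinv, hconj, ← externalFieldIntegral_eq_one_mul hinv]
  convert hasSum_integral_exp_entry hinv o v using 1
  refine integral_congr_ae (Filter.Eventually.of_forall fun U => ?_)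
  simp only
  rw [Matrix.trace_single_mul, Matrix.trace_mul_single]
  simp [mul_comm]

end Reduction

section Bessel

theorem I0_two_mul_cpow_half (z : ℂ) :
    I0 (2 * z ^ ((1 : ℂ) / 2)) = ∑' j : ℕ, z ^ j / (j.factorial : ℂ) ^ 2 := by
  have hsq : (z ^ ((1 : ℂ) / 2)) ^ 2 = z := by
    simp
  refine tsum_congr fun j => ?_
  rw [pow_mul, mul_pow, hsq, mul_pow, show (2 : ℂ) ^ 2 = 4 by norm_num]
  exact mul_div_mul_left _ _ (pow_ne_zero _ (by norm_num))

theorem integral_one_sub_pow_mul_pow (d j : ℕ) :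
    ∫ t in (0 : ℝ)..1, ((1 - t : ℝ) : ℂ) ^ d * (t : ℂ) ^ j =
      (d.factorial : ℂ) * j.factorial / (d + 1 + j).factorial := by
  have hbeta := Complex.Gamma_mul_Gamma_eq_betaIntegral (s := (j : ℂ) + 1) (t := (d : ℂ) + 1)
    (by simp; positivity) (by simp; positivity)
  rw [show (j : ℂ) + 1 + ((d : ℂ) + 1) = ((d + 1 + j : ℕ) : ℂ) + 1 by push_cast; ring,
    Complex.Gamma_nat_eq_factorial, Complex.Gamma_nat_eq_factorial,
    Complex.Gamma_nat_eq_factorial] at hbeta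
  have hfac : ((d + 1 + j).factorial : ℂ) ≠ 0 := Nat.cast_ne_zero.2 (Nat.factorial_ne_zero _)
  rw [mul_comm (d.factorial : ℂ), hbeta, mul_div_cancel_left₀ _ hfac, Complex.betaIntegral]
  simp [mul_comm]

theorem hasSum_integral_one_sub_pow_mul_I0 (d : ℕ) (z : ℂ) :
    HasSum (fun j : ℕ => (d.factorial : ℂ) *
        (z ^ j / ((j.factorial : ℂ) * (d + 1 + j).factorial)))
      (∫ t in (0 : ℝ)..1, ((1 - t : ℝ) : ℂ) ^ d * I0 (2 * (((t : ℂ) * z) ^ ((1 : ℂ) / 2)))) := by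
  have hsum : ∀ r : ℝ, Summable fun j : ℕ => r ^ j / j.factorial :=
    Real.summable_pow_div_factorial
  have hle : ∀ w : ℂ, ∀ r : ℝ, ‖w‖ ≤ r → ∀ j : ℕ,
      ‖w ^ j / (j.factorial : ℂ) ^ 2‖ ≤ r ^ j / j.factorial := by
    intro w r hw j
    rw [norm_div, norm_pow, norm_pow, Complex.norm_natCast]
    have h1 : (1 : ℝ) ≤ j.factorial := by exact_mod_cast j.factorial_pos
    have hr : 0 ≤ r := (norm_nonneg w).trans hw
    gcongr
    exact le_self_pow₀ h1 two_ne_zero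
  have hdom := intervalIntegral.hasSum_integral_of_dominated_convergence (a := 0) (b := 1)
    (μ := volume)
    (F := fun (j : ℕ) (t : ℝ) => ((1 - t : ℝ) : ℂ) ^ d * (((t : ℂ) * z) ^ j / (j.factorial : ℂ) ^ 2))
    (f := fun t : ℝ => ((1 - t : ℝ) : ℂ) ^ d * I0 (2 * (((t : ℂ) * z) ^ ((1 : ℂ) / 2))))
    (fun j _ => ‖z‖ ^ j / j.factorial)
    (fun j => by
      have : Continuous fun t : ℝ =>
        ((1 - t : ℝ) : ℂ) ^ d * (((t : ℂ) * z) ^ j / (j.factorial : ℂ) ^ 2) := by fun_prop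
      exact this.aestronglyMeasurable)
    (fun j => Filter.Eventually.of_forall fun t ht => by
      rw [Set.uIoc_of_le zero_le_one] at ht
      rw [norm_mul, norm_pow, Complex.norm_real]
      have h1 : ‖1 - t‖ ≤ 1 := by
        rw [Real.norm_eq_abs, abs_le]; constructor <;> linarith [ht.1, ht.2]
      have h2 : ‖(t : ℂ) * z‖ ≤ ‖z‖ := by
        rw [norm_mul, Complex.norm_real, Real.norm_of_nonneg ht.1.le]
        exact mul_le_of_le_one_left (norm_nonneg _) ht.2
      exact (mul_le_of_le_one_left (norm_nonneg _) (pow_le_one₀ (norm_nonneg _) h1)).trans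
        (hle _ _ h2 j))
    (Filter.Eventually.of_forall fun _ _ => hsum _)
    intervalIntegrable_const
    (Filter.Eventually.of_forall fun t _ => by
      rw [I0_two_mul_cpow_half]
      exact ((Summable.of_norm_bounded (hsum _) (hle _ _ le_rfl)).hasSum).mul_left _)
  refine hdom.congr_fun fun j => ?_
  have hpt : ∀ t : ℝ, ((1 - t : ℝ) : ℂ) ^ d * (((t : ℂ) * z) ^ j / (j.factorial : ℂ) ^ 2) =
      (((1 - t : ℝ) : ℂ) ^ d * (t : ℂ) ^ j) * (z ^ j / (j.factorial : ℂ) ^ 2) := fun t => by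
    rw [mul_pow]; ring
  simp only [hpt]
  rw [intervalIntegral.integral_mul_const, integral_one_sub_pow_mul_pow]
  have hfac : (j.factorial : ℂ) ≠ 0 := Nat.cast_ne_zero.2 (Nat.factorial_ne_zero _)
  field_simp

end Bessel

end HaarAverages

/-- If `A·B*` has rank one with unique nonzero eigenvalue `v²` (characteristic polynomial
`x^{N-1}(x - v²)`, `v² ≠ 0`), then for `N ≥ 2` the Haar average satisfies
`∫_{U(N)} exp(Tr(AU) + Tr(U*B*)) dμ_N(U) = (N-1)! Σ_{j≥0} (v²)^j/(j!(N-1+j)!)`, which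
also equals `(N-1) ∫_0^1 (1-t)^{N-2} I_0(2√(t v²)) dt`. -/
theorem haar_average_rank_one (N : ℕ) (hN : 2 ≤ N)
    (A B : Matrix (Fin N) (Fin N) ℂ) (v2 : ℂ) (hv2 : v2 ≠ 0)
    (hrank : (A * Bᴴ).rank = 1)
    (hchar : (A * Bᴴ).charpoly = X ^ (N - 1) * (X - C v2))
    (μH : Measure (Matrix.unitaryGroup (Fin N) ℂ)) [IsProbabilityMeasure μH]
    (hinv : ∀ V : Matrix.unitaryGroup (Fin N) ℂ, μH.map (fun U => V * U) = μH) :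
    ((∫ U : Matrix.unitaryGroup (Fin N) ℂ,
        Complex.exp (Matrix.trace (A * (U : Matrix (Fin N) (Fin N) ℂ)) +
          Matrix.trace (star (U : Matrix (Fin N) (Fin N) ℂ) * Bᴴ)) ∂μH)
      = ((N - 1).factorial : ℂ) *
          ∑' j : ℕ, v2 ^ j / ((j.factorial : ℂ) * (((N - 1 + j).factorial : ℂ))))
    ∧ ((∫ U : Matrix.unitaryGroup (Fin N) ℂ,
        Complex.exp (Matrix.trace (A * (U : Matrix (Fin N) (Fin N) ℂ)) +
          Matrix.trace (star (U : Matrix (Fin N) (Fin N) ℂ) * Bᴴ)) ∂μH)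
      = ((N : ℂ) - 1) *
          ∫ t in (0 : ℝ)..1, ((1 - t : ℝ) : ℂ) ^ (N - 2) *
            I0 (2 * (((t : ℂ) * v2) ^ ((1 : ℂ) / 2)))) := by
  have : Nonempty (Fin N) := ⟨⟨0, by omega⟩⟩
  obtain ⟨u, w, huw⟩ := Matrix.exists_eq_vecMulVec_of_rank_eq_one hrank
  have htrace : u ⬝ᵥ w = v2 := by
    rw [← Matrix.trace_vecMulVec, ← huw]
    exact Matrix.trace_eq_of_charpoly_eq (by simpa using hchar)
  have hI := hasSum_externalFieldIntegral_of_eq_vecMulVec hinv huw (htrace ▸ hv2)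
  rw [htrace, Fintype.card_fin] at hI
  have hseries : externalFieldIntegral μH A Bᴴ = ((N - 1).factorial : ℂ) *
      ∑' j : ℕ, v2 ^ j / ((j.factorial : ℂ) * (((N - 1 + j).factorial : ℂ))) := by
    rw [← tsum_mul_left]
    exact hI.tsum_eq.symm
  refine ⟨hseries, ?_⟩
  obtain ⟨d, rfl⟩ : ∃ d, N = d + 2 := ⟨N - 2, by omega⟩
  refine hI.unique (((hasSum_integral_one_sub_pow_mul_I0 d v2).mul_left
    (((d + 2 : ℕ) : ℂ) - 1)).congr_fun fun j => ?_)
  rw [show d + 2 - 1 = d + 1 from rfl, Nat.factorial_succ]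
  push_cast
  ring
end
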